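/- arXiv:0704.3127 — 6 statements merged into one kernel-verified Lean document; each statement's English description precedes it below -/
import Mathlib

section
/- Let A be a central simple superalgebra of odd type over F. Then A does not possess any superinvolution of the first kind (i.e. there is no F-linear graded bijection τ : A → A with τ(xy) = (−1)^{|x||y|}τ(y)τ(x) for homogeneous x, y and τ∘τ = id). -/
section Core

variable (F : Type*) {A : Type*} [Field F] [Ring A] [Algebra F A]
variable (𝒜 : ZMod 2 → Submodule F A)

/-- An F-linear superantiautomorphism. -/
def IsSuperAntiAuto (σ : A ≃ₗ[F] A) : Prop :=
  (∀ (i : ZMod 2), ∀ x ∈ 𝒜 i, σ x ∈ 𝒜 i) ∧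
  ∀ (i j : ZMod 2), ∀ x ∈ 𝒜 i, ∀ y ∈ 𝒜 j,
    σ (x * y) = ((-1 : F) ^ (i.val * j.val)) • (σ y * σ x)

/-- An F-linear superinvolution. -/
def IsSuperInvolution (σ : A ≃ₗ[F] A) : Prop :=
  IsSuperAntiAuto F 𝒜 σ ∧ ∀ x, σ (σ x) = x

/-- `σ ∘ σ` equals the grading automorphism `ν` (which is `(-1)^i` on `𝒜 i`). -/
def SquareIsGradingAuto (σ : A ≃ₗ[F] A) : Prop :=
  ∀ (i : ZMod 2), ∀ x ∈ 𝒜 i, σ (σ x) = ((-1 : F) ^ i.val) • x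

/-- The graded center reduces to `F·1`. -/
def SuperCentral : Prop :=
  ∀ (i : ZMod 2), ∀ x ∈ 𝒜 i,
    (∀ (j : ZMod 2), ∀ h ∈ 𝒜 j, x * h = ((-1 : F) ^ (i.val * j.val)) • (h * x)) →
    ∃ c : F, x = algebraMap F A c

/-- Graded simplicity: `A ≠ 0` and no proper nonzero graded two-sided ideals. -/
def SuperSimple [GradedAlgebra 𝒜] : Prop :=
  (∃ x : A, x ≠ 0) ∧
  ∀ I : TwoSidedIdeal A,
    (∀ x ∈ I, ∀ i : ZMod 2, ((DirectSum.decompose 𝒜 x i : 𝒜 i) : A) ∈ I) →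
    I = ⊥ ∨ I = ⊤

/-- Odd type: the ordinary center meets the odd part nontrivially. -/
def OddType : Prop :=
  ∃ x : A, x ≠ 0 ∧ x ∈ 𝒜 1 ∧ ∀ y : A, x * y = y * x

/-- Even type: the ordinary center meets the odd part trivially. -/
def EvenType : Prop :=
  ∀ x : A, x ∈ 𝒜 1 → (∀ y : A, x * y = y * x) → x = 0

/-- Every nonzero homogeneous element is invertible. -/
def SuperDivision : Prop :=
  ∀ (i : ZMod 2), ∀ x ∈ 𝒜 i, x ≠ 0 → IsUnit x

end Core

section OddCentral

variable {F A : Type*} [Field F] [Ring A] [Algebra F A] {𝒜 : ZMod 2 → Submodule F A}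

/-- In a graded-simple superalgebra a nonzero odd central element does not square to zero. -/
theorem SuperSimple.mul_self_ne_zero [GradedAlgebra 𝒜] (hsimple : SuperSimple F 𝒜) {z : A}
    (hz : z ≠ 0) (hz1 : z ∈ 𝒜 1) (hzc : ∀ y, z * y = y * z) : z * z ≠ 0 := by
  intro hzz
  let I : TwoSidedIdeal A := TwoSidedIdeal.mk' {x | z * x = 0} (by simp)
    (fun {x y} hx hy => by
      simp only [Set.mem_ofPred_eq] at hx hy ⊢
      rw [mul_add, hx, hy, add_zero])
    (fun {x} hx => by
      simp only [Set.mem_ofPred_eq] at hx ⊢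
      rw [mul_neg, hx, neg_zero])
    (fun {x y} hy => by
      simp only [Set.mem_ofPred_eq] at hy ⊢
      rw [← mul_assoc, hzc, mul_assoc, hy, mul_zero])
    (fun {x y} hx => by
      simp only [Set.mem_ofPred_eq] at hx ⊢
      rw [← mul_assoc, hx, zero_mul])
  have hI : ∀ x, x ∈ I ↔ z * x = 0 := fun x => by simp [I, TwoSidedIdeal.mem_mk']
  rcases hsimple.2 I (fun x hx i => by
    rw [hI] at hx ⊢
    rw [← DirectSum.coe_decompose_mul_add_of_left_mem 𝒜 hz1, hx]
    simp) with h | h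
  · have : z ∈ I := (hI z).2 hzz
    rw [h, TwoSidedIdeal.mem_bot] at this
    exact hz this
  · have : (1 : A) ∈ I := h ▸ trivial
    rw [hI, mul_one] at this
    exact hz this

/-- The product of two odd elements commuting with all homogeneous elements is a scalar. -/
theorem SuperCentral.exists_mul_eq_algebraMap [GradedAlgebra 𝒜] (hcentral : SuperCentral F 𝒜)
    {a b : A} (ha : a ∈ 𝒜 1) (hb : b ∈ 𝒜 1)
    (hac : ∀ j, ∀ y ∈ 𝒜 j, a * y = y * a) (hbc : ∀ j, ∀ y ∈ 𝒜 j, b * y = y * b) :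
    ∃ c : F, a * b = algebraMap F A c := by
  refine hcentral 0 _ (SetLike.mul_mem_graded (A := 𝒜) ha hb) fun j y hy => ?_
  rw [ZMod.val_zero, zero_mul, pow_zero, one_smul, mul_assoc, hbc j y hy, ← mul_assoc,
    hac j y hy, mul_assoc]

theorem IsSuperInvolution.map_one [GradedAlgebra 𝒜] {τ : A ≃ₗ[F] A}
    (hτ : IsSuperInvolution F 𝒜 τ) : τ 1 = 1 := by
  have h1 : (1 : A) ∈ 𝒜 0 := SetLike.one_mem_graded 𝒜
  have h := hτ.1.2 0 0 1 h1 (τ 1) (hτ.1.1 0 1 h1)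
  rw [one_mul, hτ.2, ZMod.val_zero, zero_mul, pow_zero, one_smul, one_mul] at h
  exact h.symm

/-- A superinvolution sends an odd central element to one commuting with homogeneous elements. -/
theorem IsSuperInvolution.map_comm {τ : A ≃ₗ[F] A} (hτ : IsSuperInvolution F 𝒜 τ) {z : A}
    (hz1 : z ∈ 𝒜 1) (hzc : ∀ y, z * y = y * z) (j : ZMod 2) (y : A) (hy : y ∈ 𝒜 j) :
    τ z * y = y * τ z := by
  have hw := hτ.1.1 j y hy
  have h1 := hτ.1.2 1 j z hz1 (τ y) hw
  have h2 := hτ.1.2 j 1 (τ y) hw z hz1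
  rw [hzc, h2, hτ.2, mul_comm j.val] at h1
  have hu : ((-1 : F) ^ ((1 : ZMod 2).val * j.val)) ≠ 0 := pow_ne_zero _ (by simp)
  exact smul_right_injective A hu h1

end OddCentral

/-- A central simple superalgebra of odd type has no superinvolution of the first kind. -/
theorem odd_type_no_superinvolution
    (F : Type*) {A : Type*} [Field F] [Ring A] [Algebra F A]
    (hchar : (2 : F) ≠ 0)
    (𝒜 : ZMod 2 → Submodule F A) [GradedAlgebra 𝒜]
    (hfin : FiniteDimensional F A)
    (hcentral : SuperCentral F 𝒜)
    (hsimple : SuperSimple F 𝒜)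
    (hodd : OddType F 𝒜) :
    ¬ ∃ τ : A ≃ₗ[F] A, IsSuperInvolution F 𝒜 τ := by
  rintro ⟨τ, hτ⟩
  obtain ⟨z, hz, hz1, hzc⟩ := hodd
  have : Nontrivial A := ⟨z, 0, hz⟩
  have hzc' : ∀ j, ∀ y ∈ 𝒜 j, z * y = y * z := fun _ y _ => hzc y
  obtain ⟨c, hc⟩ := hcentral.exists_mul_eq_algebraMap hz1 hz1 hzc' hzc'
  obtain ⟨d, hd⟩ := hcentral.exists_mul_eq_algebraMap hz1 (hτ.1.1 1 z hz1) hzc'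
    (hτ.map_comm hz1 hzc)
  rw [Algebra.algebraMap_eq_smul_one] at hc hd
  have hc0 : c ≠ 0 := by
    rintro rfl
    exact hsimple.mul_self_ne_zero hz hz1 hzc (by rw [hc, zero_smul])
  obtain ⟨e, he⟩ : ∃ e : F, τ z = e • z := by
    refine ⟨c⁻¹ * d, ?_⟩
    have h : c • τ z = d • z := by
      rw [← one_mul (τ z), ← smul_mul_assoc, ← hc, mul_assoc, hd, mul_smul_comm, mul_one]
    rw [mul_smul, ← h, inv_smul_smul₀ hc0]
  have hee : e * e = 1 := by
    have h := hτ.2 z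
    rw [he, map_smul, he, smul_smul] at h
    exact smul_left_injective F hz (h.trans (one_smul F z).symm)
  have h := hτ.1.2 1 1 z hz1 z hz1
  rw [he, smul_mul_smul_comm, hee, one_smul, hc, map_smul, hτ.map_one, ZMod.val_one, mul_one,
    pow_one, smul_smul] at h
  have h2 : c = -1 * c := smul_left_injective F (one_ne_zero (α := A)) h
  exact mul_ne_zero hchar hc0 (by linear_combination h2)
end

section
/- Let Δ be a central division superalgebra of even type over F with Δ₁ ≠ 0. Then Δ has no F-linear superinvolution. -/
open Module TensorProduct in
/-- The tensor product of a central division algebra with a field is a simple ring. -/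
theorem DivisionRing.isSimpleRing_tensorProduct (K D L : Type*) [Field K] [DivisionRing D]
    [Algebra K D] [Algebra.IsCentral K D] [Field L] [Algebra K L] :
    IsSimpleRing (D ⊗[K] L) := by
  classical
  have hcoeff (z : D ⊗[K] L) (e : D) (j : Basis.ofVectorSpaceIndex K L) :
      (Algebra.TensorProduct.basis D (Basis.ofVectorSpace K L)).repr (z * (e ⊗ₜ 1)) j =
      (Algebra.TensorProduct.basis D (Basis.ofVectorSpace K L)).repr z j * e := by
    induction z with
    | zero => simp
    | add x y hx hy => simp [add_mul, hx, hy]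
    | tmul a m =>
      simp [mul_assoc, Algebra.commutes]
  set b := Algebra.TensorProduct.basis D (Basis.ofVectorSpace K L) with hb
  rw [isSimpleRing_iff_isTwoSided_imp]
  refine ⟨inferInstance, fun I hI ↦ or_iff_not_imp_left.2 fun hne ↦ ?_⟩
  obtain ⟨x, ⟨hxI, hx0⟩, hmin⟩ := exists_minimalFor_of_wellFoundedLT
    (fun x : D ⊗[K] L ↦ x ∈ I ∧ x ≠ 0) (fun x ↦ (b.repr x).support.card)
    (Submodule.exists_mem_ne_zero_of_ne_bot hne)
  obtain ⟨i, hi⟩ : ∃ i, b.repr x i ≠ 0 := by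
    by_contra! h
    exact hx0 (b.repr.map_eq_zero_iff.1 (Finsupp.ext h))
  have hsmul (e : D) (z : D ⊗[K] L) : (e ⊗ₜ 1 : D ⊗[K] L) * z = e • z := by
    induction z with
    | zero => simp
    | add x y hx hy => simp [mul_add, hx, hy]
    | tmul a m => simp [smul_tmul']
  set x' := (b.repr x i)⁻¹ • x with hx'
  have hx'I : x' ∈ I := by
    rw [hx', ← hsmul]
    exact I.mul_mem_left _ hxI
  have hi' : b.repr x' i = 1 := by simp [hx', hi]
  have hsupp (j) (hj : b.repr x j = 0) : b.repr x' j = 0 := by simp [hx', hj]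
  clear_value x'
  have hcomm (e : D) : (e ⊗ₜ 1 : D ⊗[K] L) * x' = x' * (e ⊗ₜ 1) := by
    rw [← sub_eq_zero]
    by_contra hy0
    have hy : (e ⊗ₜ 1 : D ⊗[K] L) * x' - x' * (e ⊗ₜ 1) ∈ I :=
      I.sub_mem (I.mul_mem_left _ hx'I) (I.mul_mem_right _ hx'I)
    have hrepr (j) : b.repr ((e ⊗ₜ 1 : D ⊗[K] L) * x' - x' * (e ⊗ₜ 1)) j =
        e * b.repr x' j - b.repr x' j * e := by
      rw [map_sub, Finsupp.sub_apply, hcoeff, hsmul, map_smul, Finsupp.smul_apply, smul_eq_mul]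
    have hlt : (b.repr ((e ⊗ₜ 1 : D ⊗[K] L) * x' - x' * (e ⊗ₜ 1))).support ⊂
        (b.repr x).support := by
      refine Finset.ssubset_iff_subset_ne.2 ⟨fun j hj ↦ ?_, fun h ↦ ?_⟩
      · rw [Finsupp.mem_support_iff] at hj ⊢
        intro h
        exact hj (by rw [hrepr, hsupp j h]; simp)
      · have := Finsupp.mem_support_iff.2 hi
        rw [← h, Finsupp.mem_support_iff, hrepr, hi'] at this
        simp at this
    have h1 := Finset.card_lt_card hlt
    exact absurd (hmin ⟨hy, hy0⟩ h1.le) (not_le.2 h1)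
  have hcenter (j) : ∃ c : K, b.repr x' j = algebraMap K D c := by
    refine Algebra.IsCentral.mem_center_iff K |>.1 (Subalgebra.mem_center_iff.2 fun e ↦ ?_)
    rw [← hcoeff, ← hcomm, hsmul, map_smul, Finsupp.smul_apply, smul_eq_mul]
  choose c hc using hcenter
  obtain ⟨l, hl⟩ : ∃ l : L, x' = 1 ⊗ₜ l := by
    refine ⟨(b.repr x').sum fun j _ ↦ c j • Basis.ofVectorSpace K L j, ?_⟩
    conv_lhs => rw [← b.linearCombination_repr x', Finsupp.linearCombination_apply]
    rw [Finsupp.sum, Finsupp.sum, tmul_sum]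
    refine Finset.sum_congr rfl fun j _ ↦ ?_
    rw [hc, hb, Algebra.TensorProduct.basis_apply, algebraMap_smul, tmul_smul]
  have hl0 : l ≠ 0 := by
    rintro rfl
    simp [hl] at hi'
  refine (Ideal.eq_top_iff_one I).2 ?_
  have := I.mul_mem_left (1 ⊗ₜ l⁻¹) hx'I
  rwa [hl, Algebra.TensorProduct.tmul_mul_tmul, one_mul, inv_mul_cancel₀ hl0,
    ← Algebra.TensorProduct.one_def] at this

/-- An injective linear map cannot send symmetric matrices to skew-symmetric ones. -/
theorem Matrix.not_injective_of_transpose_eq_neg {L : Type*} [Field L] (h2 : (2 : L) ≠ 0)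
    {n : ℕ} [NeZero n] (P : Matrix (Fin n) (Fin n) L →ₗ[L] Matrix (Fin n) (Fin n) L)
    (hP : ∀ Y, P Y.transpose = -(P Y).transpose) : ¬ Function.Injective P := by
  intro hinj
  let s : ({p : Fin n × Fin n // p.1 ≤ p.2} → L) →ₗ[L] Matrix (Fin n) (Fin n) L :=
    { toFun := fun v ↦ Matrix.of fun i j ↦ v ⟨(min i j, max i j), min_le_max⟩
      map_add' := fun _ _ ↦ rfl
      map_smul' := fun _ _ ↦ rfl }
  have hsapply (v i j) : s v i j = v ⟨(min i j, max i j), min_le_max⟩ := rfl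
  have hs (v) : (s v).transpose = s v := by
    ext i j
    simp only [Matrix.transpose_apply, hsapply, min_comm j, max_comm j]
  let r : Matrix (Fin n) (Fin n) L →ₗ[L] ({p : Fin n × Fin n // p.1 < p.2} → L) :=
    { toFun := fun Y p ↦ Y p.1.1 p.1.2
      map_add' := fun _ _ ↦ rfl
      map_smul' := fun _ _ ↦ rfl }
  have hker (v) (hv : r (P (s v)) = 0) : v = 0 := by
    have hskew (i j) : P (s v) i j = - P (s v) j i := by
      conv_lhs => rw [← hs v, hP]
      rfl
    have hlt (i j) (hij : i < j) : P (s v) i j = 0 := congrFun hv ⟨(i, j), hij⟩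
    have hzero : P (s v) = 0 := by
      ext i j
      rcases lt_trichotomy i j with h | rfl | h
      · exact hlt i j h
      · have := hskew i i
        rw [eq_neg_iff_add_eq_zero, ← two_mul] at this
        exact (mul_eq_zero.1 this).resolve_left h2
      · rw [hskew, hlt j i h]; simp
    have hsv : s v = 0 := hinj (by rw [hzero, map_zero])
    ext ⟨⟨i, j⟩, hij⟩
    have hij' : i ≤ j := hij
    have hv := congrFun (congrFun hsv i) j
    simp only [hsapply, min_eq_left hij', max_eq_right hij'] at hv
    exact hv
  have hle := LinearMap.finrank_le_finrank_of_injective (f := r ∘ₗ P ∘ₗ s)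
    ((injective_iff_map_eq_zero _).2 hker)
  rw [Module.finrank_fintype_fun_eq_card, Module.finrank_fintype_fun_eq_card] at hle
  refine absurd hle (not_le.2 (Fintype.card_lt_of_injective_not_surjective
    (fun p ↦ ⟨p.1, p.2.le⟩) (fun p q h ↦ Subtype.ext (by simpa using h)) fun hsurj ↦ ?_))
  obtain ⟨⟨⟨i, j⟩, hij⟩, h⟩ := hsurj ⟨(0, 0), le_rfl⟩
  simp only [Subtype.mk.injEq, Prod.mk.injEq] at h
  exact hij.ne (h.1.trans h.2.symm)

/-- Skolem–Noether for matrix algebras, applied to anti-automorphisms. -/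
theorem Matrix.exists_eq_mul_transpose_mul {L : Type*} [Field L]
    {n : ℕ} (ψ : Matrix (Fin n) (Fin n) L ≃ₗ[L] Matrix (Fin n) (Fin n) L)
    (hmul : ∀ X Y, ψ (X * Y) = ψ Y * ψ X) :
    ∃ g h : Matrix (Fin n) (Fin n) L, g * h = 1 ∧ h * g = 1 ∧
      ∀ X, ψ X = g * X.transpose * h := by
  have hone : ψ 1 = 1 := by
    obtain ⟨X, hX⟩ := ψ.surjective 1
    simpa [hX] using (hmul 1 X).symm
  let f : Matrix (Fin n) (Fin n) L ≃ₐ[L] Matrix (Fin n) (Fin n) L :=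
    AlgEquiv.ofLinearEquiv ((Matrix.transposeLinearEquiv _ _ L L).trans ψ)
      (by simpa using hone) (fun X Y ↦ by simp [hmul])
  obtain ⟨T, hT⟩ := ((Matrix.toLinAlgEquiv'.symm.trans f).trans
    Matrix.toLinAlgEquiv').eq_linearEquivConjAlgEquiv
  refine ⟨LinearMap.toMatrixAlgEquiv' T.toLinearMap,
    LinearMap.toMatrixAlgEquiv' T.symm.toLinearMap, ?_, ?_, fun X ↦ ?_⟩
  · rw [← map_mul, ← map_one LinearMap.toMatrixAlgEquiv']
    congr 1
    ext; simp
  · rw [← map_mul, ← map_one LinearMap.toMatrixAlgEquiv']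
    congr 1
    ext; simp
  · have := congrArg LinearMap.toMatrixAlgEquiv'
      (DFunLike.congr_fun hT (Matrix.toLinAlgEquiv' X.transpose))
    simpa [f, LinearEquiv.conjAlgEquiv_apply, LinearMap.toMatrixAlgEquiv'_comp, mul_assoc]
      using this

/-- A linear anti-automorphism of order two of a matrix algebra does not anticommute with an
injective linear map. -/
theorem Matrix.false_of_antiInvolution_anticommute {L : Type*} [Field L] (h2 : (2 : L) ≠ 0)
    {n : ℕ} [NeZero n] (ψ T : Matrix (Fin n) (Fin n) L →ₗ[L] Matrix (Fin n) (Fin n) L)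
    (hmul : ∀ X Y, ψ (X * Y) = ψ Y * ψ X) (hinv : ∀ X, ψ (ψ X) = X)
    (hT : Function.Injective T) (hTψ : ∀ X, T (ψ X) = -ψ (T X)) : False := by
  obtain ⟨g, h, hgh, hhg, hψ⟩ :=
    Matrix.exists_eq_mul_transpose_mul (LinearEquiv.ofInvolutive ψ hinv) hmul
  replace hψ (X) : ψ X = g * X.transpose * h := hψ X
  have hghT : g.transpose * h.transpose = 1 := by
    rw [← Matrix.transpose_mul, hhg, Matrix.transpose_one]
  have hhgT : h.transpose * g.transpose = 1 := by
    rw [← Matrix.transpose_mul, hgh, Matrix.transpose_one]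
  have hcomm (X : Matrix (Fin n) (Fin n) L) : X * (g.transpose * h) = g.transpose * h * X := by
    have hX := hinv X
    simp only [hψ, Matrix.transpose_mul, Matrix.transpose_transpose] at hX
    calc X * (g.transpose * h)
        = g.transpose * (h * g) * h.transpose * X * (g.transpose * h) := by
          rw [hhg, mul_one, hghT, one_mul]
      _ = g.transpose * h * (g * (h.transpose * (X * g.transpose)) * h) := by
          simp only [mul_assoc]
      _ = g.transpose * h * X := by
          conv_rhs => rw [← hX]
  obtain ⟨c, hc⟩ : ∃ c : L, g.transpose * h = algebraMap L _ c :=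
    (Algebra.IsCentral.mem_center_iff L).1 (Subalgebra.mem_center_iff.2 fun X ↦ hcomm X)
  have hg : g.transpose = c • g := by
    rw [Algebra.smul_def, ← hc, mul_assoc, hhg, mul_one]
  have hh : h = c • h.transpose := by
    rw [Algebra.smul_def, Algebra.commutes, ← hc, ← mul_assoc, hhgT, one_mul]
  let P : Matrix (Fin n) (Fin n) L →ₗ[L] Matrix (Fin n) (Fin n) L :=
    LinearMap.mulRight L g ∘ₗ T ∘ₗ LinearMap.mulRight L h
  refine Matrix.not_injective_of_transpose_eq_neg h2 P (fun Y ↦ ?_) ?_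
  · have h1 : Y.transpose * h = c • ψ (Y * h) := by
      rw [hψ, Matrix.transpose_mul]
      conv_lhs => rw [← one_mul Y.transpose, ← hgh]
      conv_lhs => enter [1, 1, 2]; rw [hh]
      simp [mul_assoc]
    simp only [P, LinearMap.comp_apply, LinearMap.mulRight_apply, h1, map_smul, hTψ]
    rw [hψ, Matrix.transpose_mul, hg]
    simp [mul_assoc, hhg]
  · have hinj {a b : Matrix (Fin n) (Fin n) L} (hab : a * b = 1) :
        Function.Injective (LinearMap.mulRight L a) := by
      intro X Y hXY
      simpa [mul_assoc, hab] using congrArg (· * b) hXY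
    exact (hinj hgh).comp (hT.comp (hinj hhg))

open Module TensorProduct in
/-- An involution of the first kind on a central division algebra does not anticommute with an
injective linear map. -/
theorem DivisionRing.false_of_antiInvolution_anticommute {K D : Type*} [Field K] [DivisionRing D]
    [Algebra K D] [Algebra.IsCentral K D] [FiniteDimensional K D] (h2 : (2 : K) ≠ 0)
    (φ T : D →ₗ[K] D) (hmul : ∀ x y, φ (x * y) = φ y * φ x) (hinv : ∀ x, φ (φ x) = x)
    (hT : Function.Injective T) (hTφ : ∀ x, T (φ x) = -φ (T x)) : False := by
  let L := AlgebraicClosure K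
  have := DivisionRing.isSimpleRing_tensorProduct K D L
  have hsimple : IsSimpleRing (L ⊗[K] D) :=
    .of_ringEquiv (Algebra.TensorProduct.comm K D L).toRingEquiv this
  obtain ⟨n, _, ⟨e⟩⟩ := IsSimpleRing.exists_algEquiv_matrix_of_isAlgClosed L (L ⊗[K] D)
  have hmulL (x y) : φ.baseChange L (x * y) = φ.baseChange L y * φ.baseChange L x := by
    induction x with
    | zero => simp
    | add x x' hx hx' => simp [add_mul, mul_add, hx, hx']
    | tmul a d =>
      induction y with
      | zero => simp
      | add y y' hy hy' => simp only [mul_add, add_mul, map_add, hy, hy']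
      | tmul b d' => simp [hmul, mul_comm]
  have hinvL (x) : φ.baseChange L (φ.baseChange L x) = x := by
    induction x with
    | zero => simp
    | add x x' hx hx' => simp [hx, hx']
    | tmul a d => simp [hinv]
  have hTφL (x) : T.baseChange L (φ.baseChange L x) = -φ.baseChange L (T.baseChange L x) := by
    induction x with
    | zero => simp
    | add x x' hx hx' => simp only [map_add, hx, hx', neg_add]
    | tmul a d => simp [hTφ, tmul_neg]
  have hTL : Function.Injective (T.baseChange L) :=
    Module.Flat.lTensor_preserves_injective_linearMap T hT
  let c (f : L ⊗[K] D →ₗ[L] L ⊗[K] D) := e.toLinearMap ∘ₗ f ∘ₗ e.symm.toLinearMap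
  refine Matrix.false_of_antiInvolution_anticommute ?_ (c (φ.baseChange L)) (c (T.baseChange L))
    (fun X Y ↦ ?_) (fun X ↦ ?_) ?_ fun X ↦ ?_
  · simpa only [map_ofNat, map_zero] using (algebraMap K L).injective.ne h2
  · simp [c, hmulL]
  · simp [c, hinvL]
  · exact e.injective.comp (hTL.comp e.symm.injective)
  · simp [c, hTφL]

open Module in
/-- If the symmetric and skew elements of a linear involution have the same dimension, then some
injective linear map anticommutes with it. -/
theorem LinearMap.exists_injective_anticommute {K V : Type*} [Field K] [AddCommGroup V] [Module K V]
    [FiniteDimensional K V] (h2 : (2 : K) ≠ 0) (φ : V →ₗ[K] V) (hφ : ∀ x, φ (φ x) = x)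
    (hdim : finrank K (LinearMap.ker (φ - 1)) = finrank K (LinearMap.ker (φ + 1))) :
    ∃ T : V →ₗ[K] V, Function.Injective T ∧ ∀ x, T (φ x) = -φ (T x) := by
  let S := LinearEquiv.ofFinrankEq _ _ hdim
  let p : V →ₗ[K] LinearMap.ker (φ - 1) := (φ + 1).codRestrict _ fun x ↦ by simp [hφ, add_comm]
  let q : V →ₗ[K] LinearMap.ker (φ + 1) := (φ - 1).codRestrict _ fun x ↦ by simp [hφ]
  have hp (x) : (p x : V) = φ x + x := rfl
  have hq (x) : (q x : V) = φ x - x := rfl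
  have hS (y) : φ (S y : V) = -(S y : V) := by
    have := (S y).2
    rwa [LinearMap.mem_ker, LinearMap.add_apply, End.one_apply, add_eq_zero_iff_eq_neg] at this
  have hS' (y) : φ (S.symm y : V) = S.symm y := by
    have := (S.symm y).2
    rwa [LinearMap.mem_ker, LinearMap.sub_apply, End.one_apply, sub_eq_zero] at this
  have hpφ (x) : p (φ x) = p x := Subtype.ext <| by simp [hp, hφ, add_comm]
  have hqφ (x) : q (φ x) = -q x := Subtype.ext <| by simp [hq, hφ]
  refine ⟨Submodule.subtype _ ∘ₗ S.toLinearMap ∘ₗ p +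
      Submodule.subtype _ ∘ₗ S.symm.toLinearMap ∘ₗ q,
    (injective_iff_map_eq_zero _).2 fun x hx ↦ ?_, fun x ↦ ?_⟩
  · have h1 : (S (p x) : V) + S.symm (q x) = 0 := hx
    have h3 : -(S (p x) : V) + S.symm (q x) = 0 := by
      rw [← hS, ← hS' (q x), ← map_add, h1, map_zero]
    have h4 : (2 : K) • (S.symm (q x) : V) = 0 := by
      rw [two_smul, ← add_zero (0 : V)]
      nth_rw 1 [← h1]
      rw [← h3]
      abel
    have hq0 : q x = 0 := by simpa [h2] using h4
    have hp0 : p x = 0 := by simpa [hq0] using h1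
    have h5 : (2 : K) • x = (p x : V) - q x := by
      rw [two_smul, hp, hq]
      abel
    simpa [hp0, hq0, h2] using h5
  · simp [hpφ, hqφ, hS, hS', add_comm]

/-- A division ring finite-dimensional over its center has no involution of the first kind
which anticommutes with a bijection that is semilinear over the center. -/
theorem DivisionRing.false_of_semilinear_anticommute {D : Type*} [DivisionRing D]
    [FiniteDimensional (Subring.center D) D] (h2 : (2 : D) ≠ 0)
    (φ : D →+ D) (hmul : ∀ x y, φ (x * y) = φ y * φ x) (hinv : ∀ x, φ (φ x) = x)
    (hφ : ∀ k ∈ Subring.center D, φ k = k)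
    (θ : Subring.center D → Subring.center D) (hθ : Function.Bijective θ)
    (T : D ≃+ D) (hTθ : ∀ (k : Subring.center D) x, T (k * x) = θ k * T x)
    (hTφ : ∀ x, T (φ x) = -φ (T x)) : False := by
  let φ' : D →ₗ[Subring.center D] D :=
    { φ with
      map_smul' := fun k x ↦ by
        simp [Subring.smul_def, hmul, hφ k k.2, Subring.mem_center_iff.1 k.2] }
  have h2' : (2 : Subring.center D) ≠ 0 := fun h ↦ h2 (congrArg Subtype.val h)
  have hcent : Algebra.IsCentral (Subring.center D) D :=
    ⟨fun x hx ↦ Algebra.mem_bot.2 ⟨⟨x, Subring.mem_center_iff.2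
      (Subalgebra.mem_center_iff.1 hx)⟩, rfl⟩⟩
  have hmem₁ (x) : x ∈ LinearMap.ker (φ' - 1) ↔ φ x = x := by
    simp [φ', sub_eq_zero]
  have hmem₂ (x) : x ∈ LinearMap.ker (φ' + 1) ↔ φ x = -x := by
    simp [φ', add_eq_zero_iff_eq_neg]
  have hTmem (x) : T x ∈ LinearMap.ker (φ' + 1) ↔ x ∈ LinearMap.ker (φ' - 1) := by
    rw [hmem₁, hmem₂, ← T.injective.eq_iff (a := φ x), hTφ, neg_eq_iff_eq_neg]
  let j : LinearMap.ker (φ' - 1) ≃+ LinearMap.ker (φ' + 1) :=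
    { T.toEquiv.subtypeEquiv fun x ↦ (hTmem x).symm with
      map_add' := fun x y ↦ Subtype.ext (map_add T _ _) }
  have hrank := rank_eq_of_equiv_equiv θ j hθ fun k x ↦ Subtype.ext (hTθ k x)
  obtain ⟨S, hS, hSφ⟩ := LinearMap.exists_injective_anticommute h2' φ' hinv
    (congrArg Cardinal.toNat hrank)
  exact DivisionRing.false_of_antiInvolution_anticommute h2' φ' S hmul hinv hS hSφ

/-- Let `S` be a division subalgebra and `u` a unit such that `S` is stable under conjugation by `u`
and contains `u ^ 2`. An involution of the first kind on `S` does not anticommute with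
`x ↦ u * x * u`. -/
theorem Subalgebra.false_of_antiInvolution_mul_mul {F A : Type*} [Field F] [Ring A] [Algebra F A]
    [Nontrivial A] [FiniteDimensional F A] (h2 : (2 : F) ≠ 0) (S : Subalgebra F A)
    (hS : ∀ x ∈ S, x ≠ 0 → IsUnit x) {u v : A} (huv : u * v = 1) (hvu : v * u = 1)
    (hu : u * u ∈ S) (hv : v * v ∈ S)
    (hconj : ∀ x ∈ S, u * x * v ∈ S) (hconj' : ∀ x ∈ S, v * x * u ∈ S)
    (φ : A →ₗ[F] A) (hφS : ∀ x ∈ S, φ x ∈ S)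
    (hmul : ∀ x ∈ S, ∀ y ∈ S, φ (x * y) = φ y * φ x) (hinv : ∀ x ∈ S, φ (φ x) = x)
    (hφ : ∀ k ∈ S, (∀ x ∈ S, x * k = k * x) → φ k = k)
    (hφu : ∀ x ∈ S, φ (u * x * u) = -(u * φ x * u)) : False := by
  have hdom : IsDomain S :=
    { toNontrivial := inferInstance
      __ : NoZeroDivisors S := ⟨fun {a b} hab ↦ or_iff_not_imp_left.2 fun ha ↦ Subtype.ext <|
          ((hS a a.2 fun h ↦ ha (Subtype.ext h)).mul_right_eq_zero).1 (congrArg Subtype.val hab)⟩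
      __ : IsCancelMulZero S := NoZeroDivisors.toIsCancelMulZero }
  let _ : DivisionRing S := divisionRingOfFiniteDimensional F S
  let _ : Module F (Subring.center S) := inferInstanceAs (Module F (Subalgebra.center F S))
  have : IsScalarTower F (Subring.center S) S := ⟨fun a b c ↦ smul_mul_assoc a (b : S) c⟩
  have : FiniteDimensional (Subring.center S) S :=
    Module.Finite.of_restrictScalars_finite F (Subring.center S) S
  have huvl (x : A) : u * (v * x) = x := by rw [← mul_assoc, huv, one_mul]
  have hvul (x : A) : v * (u * x) = x := by rw [← mul_assoc, hvu, one_mul]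
  have hconjc (k : Subring.center S) (x : S) :
      (x : A) * (u * k * v) = u * k * v * x := by
    have := congrArg Subtype.val (Subring.mem_center_iff.1 k.2 ⟨_, hconj' x x.2⟩)
    simpa [mul_assoc, huvl, hvul, huv] using congrArg (u * · * v) this
  have hconjc' (k : Subring.center S) (x : S) :
      (x : A) * (v * k * u) = v * k * u * x := by
    have := congrArg Subtype.val (Subring.mem_center_iff.1 k.2 ⟨_, hconj x x.2⟩)
    simpa [mul_assoc, huvl, hvul, hvu] using congrArg (v * · * u) this
  let θ : Subring.center S ≃ Subring.center S :=
    { toFun k := ⟨⟨u * k * v, hconj _ k.1.2⟩,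
        Subring.mem_center_iff.2 fun x ↦ Subtype.ext (hconjc k x)⟩
      invFun k := ⟨⟨v * k * u, hconj' _ k.1.2⟩,
        Subring.mem_center_iff.2 fun x ↦ Subtype.ext (hconjc' k x)⟩
      left_inv k := Subtype.ext <| Subtype.ext <| by simp [mul_assoc, hvul, hvu]
      right_inv k := Subtype.ext <| Subtype.ext <| by simp [mul_assoc, huvl, huv] }
  have hTS (x) (hx : x ∈ S) : u * x * u ∈ S := by
    simpa [mul_assoc, hvul] using mul_mem (hconj x hx) hu
  have hTS' (x) (hx : x ∈ S) : v * x * v ∈ S := by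
    simpa [mul_assoc, huvl] using mul_mem (hconj' x hx) hv
  let T : S ≃+ S :=
    { toFun x := ⟨u * x * u, hTS _ x.2⟩
      invFun x := ⟨v * x * v, hTS' _ x.2⟩
      left_inv x := Subtype.ext <| by simp [mul_assoc, hvul, huv]
      right_inv x := Subtype.ext <| by simp [mul_assoc, huvl, hvu]
      map_add' x y := Subtype.ext <| by simp [mul_add, add_mul] }
  let φ' : S →+ S :=
    { toFun x := ⟨φ x, hφS _ x.2⟩
      map_zero' := Subtype.ext <| by simp
      map_add' x y := Subtype.ext <| by simp }
  refine DivisionRing.false_of_semilinear_anticommute ?_ φ' (fun x y ↦ Subtype.ext ?_)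
    (fun x ↦ Subtype.ext ?_) (fun k hk ↦ Subtype.ext ?_) θ θ.bijective T
    (fun k x ↦ Subtype.ext ?_) fun x ↦ Subtype.ext ?_
  · intro h
    have h' : algebraMap F S 2 = 0 := by simpa only [map_ofNat] using h
    exact h2 ((map_eq_zero_iff _ (algebraMap F S).injective).1 h')
  · exact hmul x x.2 y y.2
  · exact hinv x x.2
  · exact hφ k k.2 fun x hx ↦ congrArg Subtype.val (Subring.mem_center_iff.1 hk ⟨x, hx⟩)
  · change u * (k * x) * u = u * k * v * (u * x * u)
    simp [mul_assoc, hvul]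
  · change u * φ x * u = -φ (u * x * u)
    rw [hφu x x.2, neg_neg]

/-- A central division superalgebra of even type with `Δ₁ ≠ 0` has no `F`-linear
superinvolution. -/
theorem even_division_superalgebra_no_superinvolution
    (F : Type*) {A : Type*} [Field F] [Ring A] [Algebra F A]
    (hchar : (2 : F) ≠ 0)
    (𝒜 : ZMod 2 → Submodule F A) [GradedAlgebra 𝒜]
    (hfin : FiniteDimensional F A)
    (hcentral : SuperCentral F 𝒜)
    (hsimple : SuperSimple F 𝒜)
    (hdiv : SuperDivision F 𝒜)
    (heven : EvenType F 𝒜)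
    (hodd_ne : 𝒜 1 ≠ ⊥) :
    ¬ ∃ τ : A ≃ₗ[F] A, IsSuperInvolution F 𝒜 τ := by
  rintro ⟨τ, ⟨hτ, hττ⟩, hinv⟩
  obtain ⟨⟨a, ha⟩, -⟩ := hsimple
  have : Nontrivial A := ⟨a, 0, ha⟩
  have h00 {x y} (hx : x ∈ 𝒜 0) (hy : y ∈ 𝒜 0) : x * y ∈ 𝒜 0 := SetLike.mul_mem_graded hx hy
  have h10 {x y} (hx : x ∈ 𝒜 1) (hy : y ∈ 𝒜 0) : x * y ∈ 𝒜 1 := SetLike.mul_mem_graded hx hy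
  have h11 {x y} (hx : x ∈ 𝒜 1) (hy : y ∈ 𝒜 1) : x * y ∈ 𝒜 0 := SetLike.mul_mem_graded hx hy
  have τ00 {x y} (hx : x ∈ 𝒜 0) (hy : y ∈ 𝒜 0) : τ (x * y) = τ y * τ x := by
    simpa using hττ 0 0 x hx y hy
  have τ10 {x y} (hx : x ∈ 𝒜 1) (hy : y ∈ 𝒜 0) : τ (x * y) = τ y * τ x := by
    simpa using hττ 1 0 x hx y hy
  have τ11 {x y} (hx : x ∈ 𝒜 1) (hy : y ∈ 𝒜 1) : τ (x * y) = -(τ y * τ x) := by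
    simpa [ZMod.val_one] using hττ 1 1 x hx y hy
  have h2A {x : A} (hx : x + x = 0) : x = 0 := by
    simpa [← two_smul F, hchar] using hx
  obtain ⟨u, hu, hu0, hτu⟩ : ∃ u ∈ 𝒜 1, u ≠ 0 ∧ (τ u = u ∨ τ u = -u) := by
    obtain ⟨x, hx, hx0⟩ := Submodule.exists_mem_ne_zero_of_ne_bot hodd_ne
    by_cases h : x + τ x = 0
    · exact ⟨x, hx, hx0, .inr (eq_neg_of_add_eq_zero_right h)⟩
    · exact ⟨x + τ x, add_mem hx (hτ 1 x hx), h, .inl (by rw [map_add, hinv, add_comm])⟩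
  obtain ⟨v, hv, huv, hvu⟩ : ∃ v ∈ 𝒜 1, u * v = 1 ∧ v * u = 1 := by
    obtain ⟨⟨u, w, huw, hwu⟩, rfl⟩ := hdiv 1 u hu hu0
    have h1 : u * (DirectSum.decompose 𝒜 w 1 : A) = 1 := by
      rw [← DirectSum.coe_decompose_mul_add_of_left_mem 𝒜 hu, huw]
      exact DirectSum.decompose_of_mem_same 𝒜 (SetLike.GradedOne.one_mem : (1 : A) ∈ 𝒜 0)
    have h2 : (DirectSum.decompose 𝒜 w 1 : A) = w := by
      rw [← one_mul (DirectSum.decompose 𝒜 w 1 : A), ← hwu, mul_assoc, h1, mul_one]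
    exact ⟨w, h2 ▸ SetLike.coe_mem _, huw, hwu⟩
  have huvl (x : A) : u * (v * x) = x := by rw [← mul_assoc, huv, one_mul]
  have hvul (x : A) : v * (u * x) = x := by rw [← mul_assoc, hvu, one_mul]
  have hτuxu {x} (hx : x ∈ 𝒜 0) : τ (u * x * u) = -(u * τ x * u) := by
    rw [τ11 (h10 hu hx) hu, τ10 hu hx]
    rcases hτu with h | h <;> simp [h, mul_assoc]
  have hτ1 : τ 1 = 1 := by
    have h1 : (1 : A) ∈ 𝒜 0 := SetLike.GradedOne.one_mem
    have := τ00 h1 (hτ 0 1 h1)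
    rw [one_mul, hinv, one_mul] at this
    exact this.symm
  have hτF (c : F) : τ (algebraMap F A c) = algebraMap F A c := by
    rw [Algebra.algebraMap_eq_smul_one, map_smul, hτ1]
  have hτconj {x} (hx : x ∈ 𝒜 0) : τ (u * x * v) = v * τ x * u := by
    have h1 := τ11 hu hv
    rw [huv, hτ1] at h1
    have hτv : τ v * τ u = -1 := by rw [h1, neg_neg]
    rw [τ11 (h10 hu hx) hv, τ10 hu hx]
    rcases hτu with h | h
    · have : τ v = -v := by
        simpa [h, mul_assoc, huv] using congrArg (· * v) hτv
      simp [h, this, mul_assoc]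
    · have : τ v = v := by
        simpa [h, mul_assoc, huv] using congrArg (· * v) hτv
      simp [h, this, mul_assoc]
  let S : Subalgebra F A := SetLike.GradeZero.subalgebra 𝒜
  have hS (x) (hx : x ∈ S) (hx0 : x ≠ 0) : IsUnit x := hdiv 0 x hx hx0
  have hconj {x} (hx : x ∈ 𝒜 0) : u * x * v ∈ 𝒜 0 := h11 (h10 hu hx) hv
  have hconj' {x} (hx : x ∈ 𝒜 0) : v * x * u ∈ 𝒜 0 := h11 (h10 hv hx) hu
  by_cases hfirst : ∀ k ∈ 𝒜 0, (∀ x ∈ 𝒜 0, x * k = k * x) → τ k = k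
  · exact S.false_of_antiInvolution_mul_mul hchar hS huv hvu (h11 hu hu) (h11 hv hv)
      (fun x hx ↦ hconj hx) (fun x hx ↦ hconj' hx) τ.toLinearMap (hτ 0)
      (fun x hx y hy ↦ τ00 hx hy) (fun x _ ↦ hinv x) hfirst (fun x hx ↦ hτuxu hx)
  have hfix {k} (hk : k ∈ 𝒜 0) (hkc : ∀ x ∈ 𝒜 0, x * k = k * x) (hku : u * k * v = k) :
      ∃ c : F, k = algebraMap F A c := by
    have hku' : u * k = k * u := by
      conv_rhs => rw [← hku]
      simp [mul_assoc, hvu]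
    refine hcentral 0 k hk fun j h hj ↦ ?_
    rcases (by decide : ∀ j : ZMod 2, j = 0 ∨ j = 1) j with rfl | rfl
    · simp [hkc h hj]
    · have : h * k = k * h := by
        calc h * k = h * v * (u * k) := by simp [mul_assoc, hvul]
          _ = h * v * k * u := by rw [hku']; simp only [mul_assoc]
          _ = k * h := by rw [hkc _ (h11 hj hv)]; simp [mul_assoc, hvu]
      simp [this]
  have hconjc {k} (hkc : ∀ x ∈ 𝒜 0, x * k = k * x) :
      ∀ x ∈ 𝒜 0, x * (u * k * v) = u * k * v * x := by
    intro x hx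
    simpa [mul_assoc, huvl, hvul, huv] using congrArg (u * · * v) (hkc _ (hconj' hx))
  have hconj2 {k} (hkc : ∀ x ∈ 𝒜 0, x * k = k * x) : u * (u * k * v) * v = k := by
    calc u * (u * k * v) * v = u * u * k * (v * v) := by simp only [mul_assoc]
      _ = k := by rw [hkc _ (h11 hu hu)]; simp [mul_assoc, huvl, huv]
  have hτc {k} (hk : k ∈ 𝒜 0) (hkc : ∀ x ∈ 𝒜 0, x * k = k * x) :
      ∀ x ∈ 𝒜 0, x * τ k = τ k * x := by
    intro x hx
    have := congrArg τ (hkc _ (hτ 0 x hx))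
    rwa [τ00 hk (hτ 0 x hx), τ00 (hτ 0 x hx) hk, hinv, eq_comm] at this
  push Not at hfirst
  obtain ⟨k₀, hk₀, hk₀c, hne⟩ := hfirst
  have hadd {k} (hk : k ∈ 𝒜 0) (hkc : ∀ x ∈ 𝒜 0, x * k = k * x) :
      τ (k + u * k * v) = k + u * k * v := by
    obtain ⟨c, hc⟩ := hfix (add_mem hk (hconj hk))
      (fun x hx ↦ by rw [mul_add, add_mul, hkc x hx, hconjc hkc x hx])
      (by rw [mul_add, add_mul, hconj2 hkc, add_comm])
    rw [hc, hτF]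
  obtain ⟨y, hy, hyc, hyu, hτy, hy0⟩ : ∃ y ∈ 𝒜 0, (∀ x ∈ 𝒜 0, x * y = y * x) ∧
      u * y * v = -y ∧ τ y = -y ∧ y ≠ 0 := by
    refine ⟨k₀ - τ k₀, sub_mem hk₀ (hτ 0 _ hk₀), ?_, ?_, ?_, ?_⟩
    · intro x hx
      rw [mul_sub, sub_mul, hk₀c x hx, hτc hk₀ hk₀c x hx]
    · have h1 : u * τ k₀ * v = τ (u * k₀ * v) := by
        rw [hτconj hk₀]
        conv_rhs => rw [← hconj2 (hτc hk₀ hk₀c)]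
        simp [mul_assoc, hvul, hvu]
      have h2 := hadd hk₀ hk₀c
      rw [map_add, ← h1] at h2
      rw [mul_sub, sub_mul, eq_sub_of_add_eq' h2]
      abel
    · rw [map_sub, hinv, neg_sub]
    · exact sub_ne_zero.2 hne.symm
  have hsub {k} (hk : k ∈ 𝒜 0) (hkc : ∀ x ∈ 𝒜 0, x * k = k * x) :
      τ (k - u * k * v) = -(k - u * k * v) := by
    set z := k - u * k * v with hz
    have hz0 : z ∈ 𝒜 0 := sub_mem hk (hconj hk)
    have hzc : ∀ x ∈ 𝒜 0, x * z = z * x := fun x hx ↦ by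
      rw [mul_sub, sub_mul, hkc x hx, hconjc hkc x hx]
    have hzu : u * z * v = -z := by
      rw [hz, mul_sub, sub_mul, hconj2 hkc, neg_sub]
    have hprod {a b : A} (ha : a ∈ 𝒜 0) (hb : b ∈ 𝒜 0) (hac : ∀ x ∈ 𝒜 0, x * a = a * x)
        (hbc : ∀ x ∈ 𝒜 0, x * b = b * x) (hau : u * a * v = -a) (hbu : u * b * v = -b) :
        ∃ c : F, a * b = algebraMap F A c := by
      refine hfix (h00 ha hb) (fun x hx ↦ by
        rw [← mul_assoc, hac x hx, mul_assoc, hbc x hx, mul_assoc]) ?_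
      calc u * (a * b) * v = (u * a * v) * (u * b * v) := by simp [mul_assoc, hvul]
        _ = a * b := by rw [hau, hbu, neg_mul_neg]
    obtain ⟨f, hf⟩ := hprod hz0 hy hzc hyc hzu hyu
    obtain ⟨g, hg⟩ := hprod hy hy hyc hyc hyu hyu
    have hg0 : g ≠ 0 := by
      rintro rfl
      rw [map_zero, (hdiv 0 y hy hy0).mul_right_eq_zero] at hg
      exact hy0 hg
    have hgz : g • z = f • y := by
      rw [Algebra.smul_def, Algebra.smul_def, ← hf, ← hg, hzc _ (h00 hy hy), mul_assoc]
    have := congrArg τ hgz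
    rw [map_smul, map_smul, hτy, smul_neg, ← hgz, ← smul_neg] at this
    exact smul_right_injective A hg0 this
  refine S.false_of_antiInvolution_mul_mul hchar hS huv hvu (h11 hu hu) (h11 hv hv)
      (fun x hx ↦ hconj hx) (fun x hx ↦ hconj' hx)
      (LinearMap.mulRight F v ∘ₗ LinearMap.mulLeft F u ∘ₗ τ.toLinearMap)
      (fun x hx ↦ hconj (hτ 0 x hx)) (fun x hx y hy ↦ ?_) (fun x hx ↦ ?_) (fun k hk hkc ↦ ?_)
      fun x hx ↦ ?_
  · simp [τ00 hx hy, mul_assoc, hvul]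
  · change u * τ (u * τ x * v) * v = x
    rw [hτconj (hτ 0 x hx), hinv]
    simp [mul_assoc, huvl, huv]
  · change u * τ k * v = k
    have h1 : τ k = u * k * v := by
      have h1 := hadd hk hkc
      have h2 := hsub hk hkc
      rw [map_add] at h1
      rw [map_sub] at h2
      refine sub_eq_zero.1 (h2A ?_)
      rw [← sub_eq_zero] at h1 h2
      rw [← add_zero (0 : A)]
      nth_rw 1 [← h1]
      rw [← h2]
      abel
    rw [h1, hconj2 hkc]
  · change u * τ (u * x * u) * v = -(u * (u * τ x * v) * u)
    rw [hτuxu hx]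
    simp [mul_assoc, huv, hvu]
end

section
/- For all n, m ≥ 1, the matrix superalgebra M_{n+m}(F) has an F-linear superantiautomorphism φ with φ∘φ = ν, the grading automorphism. Moreover, M_{n+m}(F) has an F-linear superinvolution if and only if n = m or nm is even. -/
/-- The block grading on `M_{n+m}(D)`: an entry at `(i,j)` is even when `i, j` lie in the
same block and odd otherwise. -/
def matGrade (F : Type*) [Field F] (D : Type*) [Ring D] [Module F D] (n m : ℕ) (k : ZMod 2) :
    Submodule F (Matrix (Fin (n + m)) (Fin (n + m)) D) where
  carrier := {M | ∀ i j : Fin (n + m),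
    (((if (i : ℕ) < n then 0 else 1) + (if (j : ℕ) < n then 0 else 1) : ZMod 2) ≠ k) → M i j = 0}
  add_mem' := by
    intro M N hM hN i j h
    simp only [Matrix.add_apply, hM i j h, hN i j h, add_zero]
  zero_mem' := by intro i j _; rfl
  smul_mem' := by
    intro c M hM i j h
    simp only [Matrix.smul_apply, hM i j h, smul_zero]

section SuperMatrix

open Matrix

variable {F : Type*} [Field F] {n m : ℕ}

/-- The parity of a row or column index. -/
def blockParity (n m : ℕ) (i : Fin (n + m)) : ZMod 2 := if (i : ℕ) < n then 0 else 1

theorem mem_matGrade_iff {k : ZMod 2} {M : Matrix (Fin (n + m)) (Fin (n + m)) F} :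
    M ∈ matGrade F F n m k ↔
      ∀ i j, blockParity n m i + blockParity n m j ≠ k → M i j = 0 := Iff.rfl

theorem blockParity_eq_of_apply_ne_zero {k : ZMod 2}
    {M : Matrix (Fin (n + m)) (Fin (n + m)) F} (hM : M ∈ matGrade F F n m k)
    {i j : Fin (n + m)} (h : M i j ≠ 0) : blockParity n m i + blockParity n m j = k := by
  by_contra hk
  exact h (hM i j hk)

theorem zmod_two_eq_zero_or_one (a : ZMod 2) : a = 0 ∨ a = 1 := by
  revert a
  decide

theorem exists_add_of_matGrade (x : Matrix (Fin (n + m)) (Fin (n + m)) F) :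
    ∃ x₀ ∈ matGrade F F n m 0, ∃ x₁ ∈ matGrade F F n m 1, x = x₀ + x₁ := by
  refine ⟨of fun i j => if blockParity n m i + blockParity n m j = 0 then x i j else 0, ?_,
    of fun i j => if blockParity n m i + blockParity n m j = 1 then x i j else 0, ?_, ?_⟩
  · intro i j h
    exact if_neg h
  · intro i j h
    exact if_neg h
  · ext i j
    rcases zmod_two_eq_zero_or_one (blockParity n m i + blockParity n m j) with h | h <;>
      simp [h]

variable (F) in
/-- The sign `(-1) ^ (a * b)` of the Koszul rule. -/
def koszulSign (a b : ZMod 2) : F := (-1) ^ (a.val * b.val)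

theorem koszulSign_mul_self (a b : ZMod 2) : koszulSign F a b * koszulSign F a b = 1 := by
  rcases zmod_two_eq_zero_or_one a with rfl | rfl <;>
  rcases zmod_two_eq_zero_or_one b with rfl | rfl <;> simp [koszulSign, ZMod.val_one]

theorem koszulSign_cocycle (a b k : ZMod 2) :
    koszulSign F (a + 1) b =
      koszulSign F (b + k) (k + a) * koszulSign F (a + 1) k * koszulSign F (k + 1) b := by
  have h : (1 + 1 : ZMod 2) = 0 := rfl
  rcases zmod_two_eq_zero_or_one a with rfl | rfl <;>
  rcases zmod_two_eq_zero_or_one b with rfl | rfl <;>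
  rcases zmod_two_eq_zero_or_one k with rfl | rfl <;> simp [koszulSign, ZMod.val_one, h]

/-- The supertranspose on `M_{n+m}(F)`, twisted by a permutation `π` of the indices and by
signs `ε`. -/
def twistedSuperTranspose (π : Fin (n + m) → Fin (n + m)) (hπ : Function.Involutive π)
    (ε : Fin (n + m) → F) (hε : ∀ i, ε i * ε i = 1) :
    Matrix (Fin (n + m)) (Fin (n + m)) F ≃ₗ[F] Matrix (Fin (n + m)) (Fin (n + m)) F where
  toFun x := of fun i j =>
    ε i * ε j * koszulSign F (blockParity n m i + 1) (blockParity n m j) * x (π j) (π i)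
  invFun x := of fun i j =>
    ε (π i) * ε (π j) * koszulSign F (blockParity n m (π j) + 1) (blockParity n m (π i)) *
      x (π j) (π i)
  map_add' x y := by
    ext i j
    simp [mul_add]
  map_smul' c x := by
    ext i j
    simp [mul_left_comm]
  left_inv x := by
    ext i j
    simp only [of_apply, hπ i, hπ j]
    have hs := koszulSign_mul_self (F := F) (blockParity n m (π j) + 1) (blockParity n m (π i))
    set s := koszulSign F (blockParity n m (π j) + 1) (blockParity n m (π i))
    linear_combination (x i j * ε (π j) * ε (π j) * s * s) * hε (π i) +
      (x i j * s * s) * hε (π j) + x i j * hs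
  right_inv x := by
    ext i j
    simp only [of_apply, hπ i, hπ j]
    have hs := koszulSign_mul_self (F := F) (blockParity n m i + 1) (blockParity n m j)
    set s := koszulSign F (blockParity n m i + 1) (blockParity n m j)
    linear_combination (x i j * ε j * ε j * s * s) * hε i + (x i j * s * s) * hε j + x i j * hs

theorem twistedSuperTranspose_apply (π : Fin (n + m) → Fin (n + m))
    (hπ : Function.Involutive π) (ε : Fin (n + m) → F) (hε : ∀ i, ε i * ε i = 1)
    (x : Matrix (Fin (n + m)) (Fin (n + m)) F) (i j : Fin (n + m)) :
    twistedSuperTranspose π hπ ε hε x i j =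
      ε i * ε j * koszulSign F (blockParity n m i + 1) (blockParity n m j) * x (π j) (π i) :=
  rfl

theorem isSuperAntiAuto_twistedSuperTranspose (π : Fin (n + m) → Fin (n + m))
    (hπ : Function.Involutive π) (ε : Fin (n + m) → F) (hε : ∀ i, ε i * ε i = 1)
    (hp : ∀ i j, blockParity n m (π i) + blockParity n m (π j) =
      blockParity n m i + blockParity n m j) :
    IsSuperAntiAuto F (matGrade F F n m) (twistedSuperTranspose π hπ ε hε) := by
  refine ⟨fun k x hx i j hij => ?_, fun k l x hx y hy => ?_⟩
  · rw [twistedSuperTranspose_apply, hx (π j) (π i), mul_zero]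
    change _ + _ ≠ k at hij
    change blockParity n m _ + blockParity n m _ ≠ k
    rwa [hp, add_comm]
  · ext a b
    rw [twistedSuperTranspose_apply, Matrix.smul_apply, mul_apply, mul_apply, Finset.mul_sum,
      smul_eq_mul, Finset.mul_sum]
    refine (Equiv.sum_comp (hπ.toPerm π) _).symm.trans (Finset.sum_congr rfl fun c _ => ?_)
    simp only [Function.Involutive.coe_toPerm, twistedSuperTranspose_apply]
    by_cases hxc : x (π b) (π c) = 0
    · simp [hxc]
    by_cases hyc : y (π c) (π a) = 0
    · simp [hyc]
    have hk := blockParity_eq_of_apply_ne_zero hx hxc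
    have hl := blockParity_eq_of_apply_ne_zero hy hyc
    rw [hp] at hk hl
    have hs := koszulSign_cocycle (F := F) (blockParity n m a) (blockParity n m b)
      (blockParity n m c)
    rw [hk, hl] at hs
    rw [hs]
    change _ = koszulSign F k l * _
    linear_combination (-(x (π b) (π c) * y (π c) (π a) * ε a * ε b * koszulSign F k l *
      koszulSign F (blockParity n m a + 1) (blockParity n m c) *
      koszulSign F (blockParity n m c + 1) (blockParity n m b))) * hε c

variable (F n m) in
/-- The supertranspose on `M_{n+m}(F)`. -/
def superTranspose :
    Matrix (Fin (n + m)) (Fin (n + m)) F ≃ₗ[F] Matrix (Fin (n + m)) (Fin (n + m)) F :=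
  twistedSuperTranspose id (fun _ => rfl) (fun _ => 1) (fun _ => one_mul 1)

theorem superTranspose_apply (x : Matrix (Fin (n + m)) (Fin (n + m)) F) (i j : Fin (n + m)) :
    superTranspose F n m x i j =
      koszulSign F (blockParity n m i + 1) (blockParity n m j) * x j i := by
  refine (twistedSuperTranspose_apply ..).trans ?_
  rw [one_mul, one_mul, id, id]

theorem isSuperAntiAuto_superTranspose :
    IsSuperAntiAuto F (matGrade F F n m) (superTranspose F n m) :=
  isSuperAntiAuto_twistedSuperTranspose _ _ _ _ fun _ _ => rfl

variable (F) in
/-- The sign of an index: `1` on the first block and `-1` on the second. -/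
def blockSign (n m : ℕ) (i : Fin (n + m)) : F := (-1) ^ (blockParity n m i).val

theorem blockSign_mul_self (i : Fin (n + m)) : blockSign F n m i * blockSign F n m i = 1 := by
  rcases zmod_two_eq_zero_or_one (blockParity n m i) with h | h <;>
    simp [blockSign, h, ZMod.val_one]

theorem koszulSign_mul_swap (i j : Fin (n + m)) :
    koszulSign F (blockParity n m i + 1) (blockParity n m j) *
      koszulSign F (blockParity n m j + 1) (blockParity n m i) =
    blockSign F n m i * blockSign F n m j := by
  have h2 : (1 + 1 : ZMod 2) = 0 := rfl
  rcases zmod_two_eq_zero_or_one (blockParity n m i) with h | h <;>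
  rcases zmod_two_eq_zero_or_one (blockParity n m j) with h' | h' <;>
    simp [blockSign, koszulSign, h, h', ZMod.val_one, h2]

theorem blockSign_mul_blockSign (i j : Fin (n + m)) :
    blockSign F n m i * blockSign F n m j =
      (-1) ^ (blockParity n m i + blockParity n m j).val := by
  have h2 : (1 + 1 : ZMod 2) = 0 := rfl
  rcases zmod_two_eq_zero_or_one (blockParity n m i) with h | h <;>
  rcases zmod_two_eq_zero_or_one (blockParity n m j) with h' | h' <;>
    simp [blockSign, h, h', ZMod.val_one, h2]

variable (F) in
/-- The diagonal matrix whose conjugation action is the grading automorphism. -/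
def gradingMatrix (n m : ℕ) : Matrix (Fin (n + m)) (Fin (n + m)) F :=
  diagonal (blockSign F n m)

theorem gradingMatrix_mul_self : gradingMatrix F n m * gradingMatrix F n m = 1 := by
  simp [gradingMatrix, blockSign_mul_self]

theorem gradingMatrix_conj_apply (x : Matrix (Fin (n + m)) (Fin (n + m)) F)
    (i j : Fin (n + m)) :
    (gradingMatrix F n m * x * gradingMatrix F n m) i j =
      blockSign F n m i * blockSign F n m j * x i j := by
  rw [gradingMatrix, mul_diagonal, diagonal_mul]
  ring

theorem gradingMatrix_conj_of_mem {k : ZMod 2} {x : Matrix (Fin (n + m)) (Fin (n + m)) F}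
    (hx : x ∈ matGrade F F n m k) :
    gradingMatrix F n m * x * gradingMatrix F n m = (-1 : F) ^ k.val • x := by
  ext i j
  rw [gradingMatrix_conj_apply, Matrix.smul_apply, smul_eq_mul, blockSign_mul_blockSign]
  by_cases h : x i j = 0
  · simp [h]
  · rw [blockParity_eq_of_apply_ne_zero hx h]

theorem superTranspose_superTranspose (x : Matrix (Fin (n + m)) (Fin (n + m)) F) :
    superTranspose F n m (superTranspose F n m x) =
      gradingMatrix F n m * x * gradingMatrix F n m := by
  ext i j
  rw [superTranspose_apply, superTranspose_apply, gradingMatrix_conj_apply, ← mul_assoc,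
    koszulSign_mul_swap]

theorem squareIsGradingAuto_superTranspose :
    SquareIsGradingAuto F (matGrade F F n m) (superTranspose F n m) := fun k x hx => by
  rw [superTranspose_superTranspose, gradingMatrix_conj_of_mem hx]

theorem isSuperInvolution_twistedSuperTranspose (π : Fin (n + m) → Fin (n + m))
    (hπ : Function.Involutive π) (ε : Fin (n + m) → F) (hε : ∀ i, ε i * ε i = 1)
    (hp : ∀ i j, blockParity n m (π i) + blockParity n m (π j) =
      blockParity n m i + blockParity n m j)
    (h : ∀ i j, ε i * ε j * koszulSign F (blockParity n m i + 1) (blockParity n m j) *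
      (ε (π j) * ε (π i) *
        koszulSign F (blockParity n m (π j) + 1) (blockParity n m (π i))) = 1) :
    IsSuperInvolution F (matGrade F F n m) (twistedSuperTranspose π hπ ε hε) := by
  refine ⟨isSuperAntiAuto_twistedSuperTranspose π hπ ε hε hp, fun x => ?_⟩
  ext i j
  rw [twistedSuperTranspose_apply, twistedSuperTranspose_apply, hπ, hπ, ← mul_assoc, h, one_mul]

theorem exists_isSuperInvolution_of_eq :
    ∃ τ : Matrix (Fin (n + n)) (Fin (n + n)) F ≃ₗ[F] Matrix (Fin (n + n)) (Fin (n + n)) F,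
      IsSuperInvolution F (matGrade F F n n) τ := by
  have h2 : (1 + 1 : ZMod 2) = 0 := rfl
  have hrev (i : Fin (n + n)) : blockParity n n i.rev = blockParity n n i + 1 := by
    by_cases h : (i : ℕ) < n
    · have : ¬ (i.rev : ℕ) < n := by rw [Fin.val_rev]; omega
      simp only [blockParity, h, this, if_true, if_false, zero_add]
    · have : (i.rev : ℕ) < n := by rw [Fin.val_rev]; omega
      simp only [blockParity, h, this, if_true, if_false, h2]
  refine ⟨_, isSuperInvolution_twistedSuperTranspose Fin.rev Fin.rev_involutive (fun _ => 1)
    (fun _ => one_mul 1) (fun i j => ?_) fun i j => ?_⟩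
  · rw [hrev, hrev, add_add_add_comm, h2, add_zero]
  · rw [hrev, hrev]
    rcases zmod_two_eq_zero_or_one (blockParity n n i) with hi | hi <;>
    rcases zmod_two_eq_zero_or_one (blockParity n n j) with hj | hj <;>
      simp [koszulSign, hi, hj, h2, ZMod.val_one]

/-- A permutation of the indices preserving the blocks, with signs that it flips on exactly one
block, gives rise to an orthosymplectic superinvolution. -/
theorem isSuperInvolution_twistedSuperTranspose_of_sign (π : Fin (n + m) → Fin (n + m))
    (hπ : Function.Involutive π) (ε : Fin (n + m) → F) (hε : ∀ i, ε i * ε i = 1)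
    (hp : ∀ i, blockParity n m (π i) = blockParity n m i) (s : F) (hs : s * s = 1)
    (h : ∀ i, ε (π i) * ε i = s * blockSign F n m i) :
    IsSuperInvolution F (matGrade F F n m) (twistedSuperTranspose π hπ ε hε) := by
  refine isSuperInvolution_twistedSuperTranspose π hπ ε hε (fun i j => by rw [hp, hp])
    fun i j => ?_
  rw [hp, hp]
  have hk := koszulSign_mul_swap (F := F) i j
  calc _ = (ε (π i) * ε i) * (ε (π j) * ε j) *
        (koszulSign F (blockParity n m i + 1) (blockParity n m j) *
          koszulSign F (blockParity n m j + 1) (blockParity n m i)) := by ring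
    _ = (s * s) * (blockSign F n m i * blockSign F n m i) *
        (blockSign F n m j * blockSign F n m j) := by rw [h, h, hk]; ring
    _ = 1 := by rw [hs, blockSign_mul_self, blockSign_mul_self, one_mul, one_mul]

theorem exists_isSuperInvolution_of_even_left (hn : Even n) :
    ∃ τ : Matrix (Fin (n + m)) (Fin (n + m)) F ≃ₗ[F] Matrix (Fin (n + m)) (Fin (n + m)) F,
      IsSuperInvolution F (matGrade F F n m) τ := by
  obtain ⟨r, rfl⟩ := hn
  refine ⟨_, isSuperInvolution_twistedSuperTranspose_of_sign
    (fun i => if h : (i : ℕ) < r + r then ⟨r + r - 1 - i, by omega⟩ else i) (fun i => ?_)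
    (fun i => if (i : ℕ) < r then -1 else 1) (fun i => ?_) (fun i => ?_) (-1) (by simp)
    fun i => ?_⟩
  · by_cases h : (i : ℕ) < r + r
    · have h' : r + r - 1 - (i : ℕ) < r + r := by omega
      ext
      simp only [h, h', dite_true]
      omega
    · simp [h]
  · split_ifs <;> simp
  · by_cases h : (i : ℕ) < r + r
    · have h' : r + r - 1 - (i : ℕ) < r + r := by omega
      simp [blockParity, h, h']
    · simp [h]
  · by_cases h : (i : ℕ) < r + r
    · by_cases h₁ : (i : ℕ) < r
      · have h' : ¬ r + r - 1 - (i : ℕ) < r := by omega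
        simp [blockSign, blockParity, h, h₁, h']
      · have h' : r + r - 1 - (i : ℕ) < r := by omega
        simp [blockSign, blockParity, h, h₁, h']
    · have h' : ¬ (i : ℕ) < r := by omega
      simp [blockSign, blockParity, h, h', ZMod.val_one]

theorem exists_isSuperInvolution_of_even_right (hm : Even m) :
    ∃ τ : Matrix (Fin (n + m)) (Fin (n + m)) F ≃ₗ[F] Matrix (Fin (n + m)) (Fin (n + m)) F,
      IsSuperInvolution F (matGrade F F n m) τ := by
  obtain ⟨r, rfl⟩ := hm
  refine ⟨_, isSuperInvolution_twistedSuperTranspose_of_sign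
    (fun i => if h : (i : ℕ) < n then i else ⟨n + (n + (r + r)) - 1 - i, by omega⟩)
    (fun i => ?_) (fun i => if (i : ℕ) < n + r then 1 else -1) (fun i => ?_) (fun i => ?_) 1
    (one_mul 1) fun i => ?_⟩
  · by_cases h : (i : ℕ) < n
    · simp [h]
    · have h' : ¬ n + (n + (r + r)) - 1 - (i : ℕ) < n := by omega
      ext
      simp only [h, h', dite_false]
      omega
  · split_ifs <;> simp
  · by_cases h : (i : ℕ) < n
    · simp [h]
    · have h' : ¬ n + (n + (r + r)) - 1 - (i : ℕ) < n := by omega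
      simp only [blockParity, h, h', dite_false, if_false]
  · by_cases h : (i : ℕ) < n
    · have h' : (i : ℕ) < n + r := by omega
      simp [blockSign, blockParity, h, h']
    · by_cases h₁ : (i : ℕ) < n + r
      · have h' : ¬ n + (n + (r + r)) - 1 - (i : ℕ) < n + r := by omega
        simp [blockSign, blockParity, h, h₁, h', ZMod.val_one]
      · have h' : n + (n + (r + r)) - 1 - (i : ℕ) < n + r := by omega
        simp [blockSign, blockParity, h, h₁, h', ZMod.val_one]

theorem exists_conj_of_mul_preserving
    (θ : Matrix (Fin (n + m)) (Fin (n + m)) F ≃ₗ[F] Matrix (Fin (n + m)) (Fin (n + m)) F)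
    (hθ : ∀ x y, θ (x * y) = θ x * θ y) :
    ∃ P : Matrix (Fin (n + m)) (Fin (n + m)) F, IsUnit P ∧ ∀ x, P * x = θ x * P := by
  have h1 : θ 1 = 1 := by
    have h := hθ 1 (θ.symm 1)
    simpa using h.symm
  let f : Module.End F (Fin (n + m) → F) ≃ₐ[F] Module.End F (Fin (n + m) → F) :=
    (toLinAlgEquiv'.symm.trans (AlgEquiv.ofLinearEquiv θ h1 hθ)).trans toLinAlgEquiv'
  obtain ⟨T, hT⟩ := f.eq_linearEquivConjAlgEquiv
  have hTx (x : Matrix (Fin (n + m)) (Fin (n + m)) F) :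
      toLinAlgEquiv' (θ x) = T.toLinearMap ∘ₗ toLinAlgEquiv' x ∘ₗ T.symm.toLinearMap := by
    have h := DFunLike.congr_fun hT (toLinAlgEquiv' x)
    simpa [f, LinearEquiv.conjAlgEquiv_apply] using h
  refine ⟨toLinAlgEquiv'.symm T.toLinearMap, ?_, fun x => ?_⟩
  · refine IsUnit.map _ ?_
    exact (LinearMap.GeneralLinearGroup.ofLinearEquiv T).isUnit
  · apply toLinAlgEquiv'.injective
    rw [map_mul, map_mul, hTx, AlgEquiv.apply_symm_apply]
    ext1 i
    ext j
    simp

theorem exists_smul_of_intertwines {ι : Type*} [Fintype ι] [DecidableEq ι]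
    {θ : Matrix ι ι F → Matrix ι ι F} {P Q : Matrix ι ι F} (hP : IsUnit P)
    (hPθ : ∀ x, P * x = θ x * P) (hQθ : ∀ x, Q * x = θ x * Q) : ∃ c : F, Q = c • P := by
  obtain ⟨u, rfl⟩ := hP
  have hc (x : Matrix ι ι F) : Commute x (u⁻¹.val * Q) := by
    have h : x = u⁻¹.val * θ x * u.val := by
      rw [mul_assoc, ← hPθ, Units.inv_mul_cancel_left]
    calc x * (u⁻¹.val * Q) = u⁻¹.val * θ x * ↑u * (u⁻¹.val * Q) := by rw [← h]
      _ = u⁻¹.val * (θ x * Q) := by rw [mul_assoc, Units.mul_inv_cancel_left, mul_assoc]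
      _ = u⁻¹.val * Q * x := by rw [← hQθ, mul_assoc]
  obtain ⟨c, hc⟩ := mem_range_scalar_iff_commute_single'.mpr fun i j => hc (single i j 1)
  refine ⟨c, ?_⟩
  rw [← u.mul_inv_cancel_left Q, ← hc, scalar_apply, ← smul_one_eq_diagonal, mul_smul_comm, mul_one]

theorem IsSuperAntiAuto.map_mul_of_mem_zero
    {φ : Matrix (Fin (n + m)) (Fin (n + m)) F ≃ₗ[F] Matrix (Fin (n + m)) (Fin (n + m)) F}
    (hφ : IsSuperAntiAuto F (matGrade F F n m) φ) {P : Matrix (Fin (n + m)) (Fin (n + m)) F}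
    (hP : P ∈ matGrade F F n m 0) (x : Matrix (Fin (n + m)) (Fin (n + m)) F) :
    φ (P * x) = φ x * φ P ∧ φ (x * P) = φ P * φ x := by
  obtain ⟨x₀, h₀, x₁, h₁, rfl⟩ := exists_add_of_matGrade x
  rw [mul_add, add_mul, map_add, map_add, map_add, hφ.2 0 0 P hP x₀ h₀, hφ.2 0 1 P hP x₁ h₁,
    hφ.2 0 0 x₀ h₀ P hP, hφ.2 1 0 x₁ h₁ P hP, add_mul, mul_add]
  simp

theorem IsSuperAntiAuto.comp_map_mul
    {φ τ : Matrix (Fin (n + m)) (Fin (n + m)) F ≃ₗ[F] Matrix (Fin (n + m)) (Fin (n + m)) F}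
    (hφ : IsSuperAntiAuto F (matGrade F F n m) φ) (hτ : IsSuperAntiAuto F (matGrade F F n m) τ)
    (x y : Matrix (Fin (n + m)) (Fin (n + m)) F) :
    φ (τ (x * y)) = φ (τ x) * φ (τ y) := by
  have key {i j : ZMod 2} {x y : Matrix (Fin (n + m)) (Fin (n + m)) F}
      (hx : x ∈ matGrade F F n m i) (hy : y ∈ matGrade F F n m j) :
      φ (τ (x * y)) = φ (τ x) * φ (τ y) := by
    rw [hτ.2 i j x hx y hy, map_smul, hφ.2 j i _ (hτ.1 j y hy) _ (hτ.1 i x hx), smul_smul,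
      mul_comm j.val, ← mul_pow]
    simp
  obtain ⟨x₀, hx₀, x₁, hx₁, rfl⟩ := exists_add_of_matGrade x
  obtain ⟨y₀, hy₀, y₁, hy₁, rfl⟩ := exists_add_of_matGrade y
  simp only [add_mul, mul_add, map_add, key hx₀ hy₀, key hx₀ hy₁, key hx₁ hy₀, key hx₁ hy₁]

theorem gradingMatrix_conj_comm
    {θ : Matrix (Fin (n + m)) (Fin (n + m)) F ≃ₗ[F] Matrix (Fin (n + m)) (Fin (n + m)) F}
    (hθ : ∀ k, ∀ x ∈ matGrade F F n m k, θ x ∈ matGrade F F n m k)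
    (x : Matrix (Fin (n + m)) (Fin (n + m)) F) :
    θ (gradingMatrix F n m * x * gradingMatrix F n m) =
      gradingMatrix F n m * θ x * gradingMatrix F n m := by
  obtain ⟨x₀, h₀, x₁, h₁, rfl⟩ := exists_add_of_matGrade x
  simp only [mul_add, add_mul, map_add, gradingMatrix_conj_of_mem h₀,
    gradingMatrix_conj_of_mem h₁, gradingMatrix_conj_of_mem (hθ 0 _ h₀),
    gradingMatrix_conj_of_mem (hθ 1 _ h₁), map_smul]

/-- An invertible matrix which intertwines a graded automorphism is homogeneous. -/
theorem exists_mem_matGrade_of_intertwines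
    {θ : Matrix (Fin (n + m)) (Fin (n + m)) F ≃ₗ[F] Matrix (Fin (n + m)) (Fin (n + m)) F}
    (hchar : (2 : F) ≠ 0) (hθ : ∀ k, ∀ x ∈ matGrade F F n m k, θ x ∈ matGrade F F n m k)
    {P : Matrix (Fin (n + m)) (Fin (n + m)) F} (hP : IsUnit P)
    (hPθ : ∀ x, P * x = θ x * P) : ∃ k, P ∈ matGrade F F n m k := by
  have hg := gradingMatrix_mul_self (F := F) (n := n) (m := m)
  obtain ⟨c, hc⟩ := exists_smul_of_intertwines
    (Q := gradingMatrix F n m * P * gradingMatrix F n m) hP hPθ fun x => by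
      set g := gradingMatrix F n m
      calc g * P * g * x = g * P * g * x * (g * g) := by rw [hg, mul_one]
        _ = g * (P * (g * x * g)) * g := by simp only [mul_assoc]
        _ = (g * g) * θ x * (g * P * g) := by
          rw [hPθ, gradingMatrix_conj_comm hθ]
          simp only [g, mul_assoc]
        _ = θ x * (g * P * g) := by rw [hg, one_mul]
  have hs (i j : Fin (n + m)) (h : P i j ≠ 0) :
      (-1 : F) ^ (blockParity n m i + blockParity n m j).val = c := by
    have h' := congrFun (congrFun hc i) j
    rw [gradingMatrix_conj_apply, Matrix.smul_apply, smul_eq_mul, blockSign_mul_blockSign] at h'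
    exact mul_right_cancel₀ h h'
  have hne : (1 : F) ≠ -1 := fun h => hchar (by linear_combination h)
  by_cases hc1 : c = 1
  · refine ⟨0, fun i j hij => by_contra fun h => ?_⟩
    have h1 : blockParity n m i + blockParity n m j = 1 :=
      (zmod_two_eq_zero_or_one _).resolve_left hij
    have := hs i j h
    rw [h1, hc1] at this
    exact hne (by simpa [ZMod.val_one] using this.symm)
  · refine ⟨1, fun i j hij => by_contra fun h => ?_⟩
    have h1 : blockParity n m i + blockParity n m j = 0 :=
      (zmod_two_eq_zero_or_one _).resolve_right hij
    have := hs i j h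
    rw [h1] at this
    exact hc1 (by simpa using this.symm)

theorem card_blockParity_eq_zero : Fintype.card {i // blockParity n m i = 0} = n := by
  have h (i : Fin (n + m)) : blockParity n m i = 0 ↔ (i : ℕ) < n := by
    simp [blockParity]
  rw [Fintype.card_subtype, Finset.filter_congr fun i _ => h i, Fin.card_filter_val_lt]
  exact min_eq_right (Nat.le_add_right n m)

theorem card_not_blockParity_eq_zero : Fintype.card {i // ¬ blockParity n m i = 0} = m := by
  rw [Fintype.card_subtype_compl, card_blockParity_eq_zero, Fintype.card_fin,
    Nat.add_sub_cancel_left]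

/-- An invertible odd matrix exists only if the two blocks have the same size. -/
theorem eq_of_isUnit_of_mem_matGrade_one {P : Matrix (Fin (n + m)) (Fin (n + m)) F}
    (hP : IsUnit P) (h : P ∈ matGrade F F n m 1) : n = m := by
  classical
  let e : Fin (n + m) → F := fun i => if blockParity n m i = 0 then 1 else 0
  let e' : Fin (n + m) → F := fun i => if blockParity n m i = 0 then 0 else 1
  have hPe : P * diagonal e = diagonal e' * P := by
    ext i j
    rw [mul_diagonal, diagonal_mul]
    by_cases hz : P i j = 0
    · simp [hz]
    have hij := blockParity_eq_of_apply_ne_zero h hz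
    have h2 : (1 + 1 : ZMod 2) = 0 := rfl
    rcases zmod_two_eq_zero_or_one (blockParity n m i) with hi | hi <;>
    rcases zmod_two_eq_zero_or_one (blockParity n m j) with hj | hj <;>
      simp_all [e, e']
  have hdet := (isUnit_iff_isUnit_det P).mp hP
  have hr : (diagonal e).rank = (diagonal e').rank := by
    rw [← rank_mul_eq_right_of_isUnit_det P _ hdet, hPe, rank_mul_eq_left_of_isUnit_det P _ hdet]
  rw [rank_diagonal, rank_diagonal] at hr
  have h1 : Fintype.card {i // e i ≠ 0} = n := by
    simpa [e] using card_blockParity_eq_zero (n := n) (m := m)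
  have h2 : Fintype.card {i // e' i ≠ 0} = m := by
    simpa [e'] using card_not_blockParity_eq_zero (n := n) (m := m)
  exact h1.symm.trans (hr.trans h2)

theorem even_card_of_transpose_eq_neg {ι : Type*} [Fintype ι] [DecidableEq ι]
    (hchar : (2 : F) ≠ 0) {M : Matrix ι ι F} (hM : M.det ≠ 0) (h : Mᵀ = -M) :
    Even (Fintype.card ι) := by
  by_contra hodd
  have hd := congrArg det h
  rw [det_transpose, det_neg, (Nat.not_even_iff_odd.mp hodd).neg_one_pow] at hd
  have : (2 : F) * M.det = 0 := by linear_combination hd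
  exact (mul_ne_zero hchar hM) this

theorem even_mul_of_isUnit_of_transpose (hchar : (2 : F) ≠ 0)
    {P : Matrix (Fin (n + m)) (Fin (n + m)) F} (hP : IsUnit P) (h : P ∈ matGrade F F n m 0)
    {c : F} (hc : Pᵀ * gradingMatrix F n m = c • P) : Even (n * m) := by
  rcases Nat.eq_zero_or_pos (n + m) with hnm | hnm
  · simp [Nat.eq_zero_of_add_eq_zero_right hnm]
  have happ (i j : Fin (n + m)) : P j i * blockSign F n m j = c * P i j := by
    have := congrFun (congrFun hc i) j
    rwa [gradingMatrix, mul_diagonal, transpose_apply, Matrix.smul_apply, smul_eq_mul] at this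
  have hdet := ((isUnit_iff_isUnit_det P).mp hP).ne_zero
  rw [twoBlockTriangular_det P (fun i => blockParity n m i = 0) fun i hi j hj =>
    h i j (by change blockParity n m i + blockParity n m j ≠ 0; rwa [hj, add_zero])] at hdet
  obtain ⟨h₀, h₁⟩ := mul_ne_zero_iff.mp hdet
  have hcc : c = 1 ∨ c = -1 := by
    obtain ⟨i, j, hij⟩ : ∃ i j, P i j ≠ 0 := by
      by_contra! hz
      have : Nonempty (Fin (n + m)) := ⟨⟨0, hnm⟩⟩
      have hP0 : P = 0 := by
        ext i j
        exact hz i j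
      exact hP.ne_zero hP0
    have hpar := blockParity_eq_of_apply_ne_zero h hij
    have hs := blockSign_mul_blockSign (F := F) i j
    rw [hpar] at hs
    simp at hs
    have : (c * c - 1) * P i j = 0 := by
      linear_combination (-c) * happ i j - blockSign F n m j * happ j i + P i j * hs
    have := (mul_eq_zero.mp this).resolve_right hij
    exact mul_self_eq_one_iff.mp (by linear_combination this)
  rcases hcc with rfl | rfl
  · refine Even.mul_left ?_ n
    rw [← card_not_blockParity_eq_zero (n := n) (m := m)]
    refine even_card_of_transpose_eq_neg hchar h₁ ?_
    ext ⟨i, hi⟩ ⟨j, hj⟩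
    have hb : blockSign F n m j = -1 := by
      simp [blockSign, (zmod_two_eq_zero_or_one _).resolve_left hj, ZMod.val_one]
    have := happ i j
    rw [hb] at this
    change P j i = -P i j
    linear_combination -this
  · refine Even.mul_right ?_ m
    rw [← card_blockParity_eq_zero (n := n) (m := m)]
    refine even_card_of_transpose_eq_neg hchar h₀ ?_
    ext ⟨i, hi⟩ ⟨j, hj⟩
    have hb : blockSign F n m j = 1 := by
      simp [blockSign, hj]
    have := happ i j
    rw [hb] at this
    change P j i = -P i j
    linear_combination this

theorem superTranspose_of_mem_zero {P : Matrix (Fin (n + m)) (Fin (n + m)) F}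
    (hP : P ∈ matGrade F F n m 0) : superTranspose F n m P = Pᵀ := by
  ext i j
  rw [superTranspose_apply, transpose_apply]
  by_cases h : P j i = 0
  · simp [h]
  have hpar := blockParity_eq_of_apply_ne_zero hP h
  have h2 : (1 + 1 : ZMod 2) = 0 := rfl
  rcases zmod_two_eq_zero_or_one (blockParity n m i) with hi | hi <;>
  rcases zmod_two_eq_zero_or_one (blockParity n m j) with hj | hj <;>
    simp_all [koszulSign]

theorem IsSuperInvolution.eq_or_even (hchar : (2 : F) ≠ 0)
    {τ : Matrix (Fin (n + m)) (Fin (n + m)) F ≃ₗ[F] Matrix (Fin (n + m)) (Fin (n + m)) F}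
    (hτ : IsSuperInvolution F (matGrade F F n m) τ) : n = m ∨ Even (n * m) := by
  obtain ⟨hτ, hinv⟩ := hτ
  have hφ := isSuperAntiAuto_superTranspose (F := F) (n := n) (m := m)
  set φ := superTranspose F n m with hφdef
  obtain ⟨P, hP, hPθ⟩ := exists_conj_of_mul_preserving (τ.trans φ) (hφ.comp_map_mul hτ)
  obtain ⟨k, hk⟩ := exists_mem_matGrade_of_intertwines hchar
    (θ := τ.trans φ) (fun k x hx => hφ.1 k _ (hτ.1 k x hx)) hP hPθ
  rcases zmod_two_eq_zero_or_one k with rfl | rfl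
  · right
    obtain ⟨c, hc⟩ := exists_smul_of_intertwines (Q := Pᵀ * gradingMatrix F n m) hP hPθ
      fun x => by
        have h := congrArg φ (hPθ (τ x))
        rw [LinearEquiv.trans_apply, hinv, (hφ.map_mul_of_mem_zero hk _).1,
          (hφ.map_mul_of_mem_zero hk _).2, hφdef, superTranspose_superTranspose,
          superTranspose_of_mem_zero hk] at h
        rw [LinearEquiv.trans_apply, ← mul_assoc, h]
        simp only [mul_assoc, gradingMatrix_mul_self, mul_one]
    exact even_mul_of_isUnit_of_transpose hchar hP hk hc
  · exact Or.inl (eq_of_isUnit_of_mem_matGrade_one hP hk)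

end SuperMatrix

/-- The matrix superalgebra `M_{n+m}(F)` always has a superantiautomorphism whose square is
the grading automorphism; it has a superinvolution iff `n = m` or `nm` is even. -/
theorem matrix_superalgebra_antiauto_and_superinvolution_iff
    (F : Type*) [Field F] (hchar : (2 : F) ≠ 0)
    (n m : ℕ) (hn : 1 ≤ n) (hm : 1 ≤ m) :
    (∃ φ : Matrix (Fin (n + m)) (Fin (n + m)) F ≃ₗ[F] Matrix (Fin (n + m)) (Fin (n + m)) F,
        IsSuperAntiAuto F (matGrade F F n m) φ ∧ SquareIsGradingAuto F (matGrade F F n m) φ) ∧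
    ((∃ τ : Matrix (Fin (n + m)) (Fin (n + m)) F ≃ₗ[F] Matrix (Fin (n + m)) (Fin (n + m)) F,
        IsSuperInvolution F (matGrade F F n m) τ) ↔ (n = m ∨ Even (n * m))) := by
  refine ⟨⟨superTranspose F n m, isSuperAntiAuto_superTranspose,
    squareIsGradingAuto_superTranspose⟩, fun ⟨τ, hτ⟩ => hτ.eq_or_even hchar, ?_⟩
  rintro (rfl | h)
  · exact exists_isSuperInvolution_of_eq
  · rcases Nat.even_mul.mp h with h | h
    · exact exists_isSuperInvolution_of_even_left h
    · exact exists_isSuperInvolution_of_even_right h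
end

section
/- (Graded Skolem–Noether) Let A be a central simple superalgebra over F. Then every graded F-algebra automorphism φ of A is inner: there exists a homogeneous invertible element a ∈ A (a ∈ A₀ or a ∈ A₁) such that φ(x) = (−1)^{|a||x|} a x a⁻¹ for all homogeneous x ∈ A. Moreover, no graded automorphism is simultaneously of this form for an even invertible a and for an odd invertible a (the sets ι_{A₀^×} and ι_{A₁^×} are disjoint). -/
section GradedSkolemNoether

open TensorProduct DirectSum Module

variable {F A : Type*} [Field F] [Ring A] [Algebra F A]
variable (𝒜 : ZMod 2 → Submodule F A) [GradedAlgebra 𝒜]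

theorem ZMod.two_cases {P : ZMod 2 → Prop} (h0 : P 0) (h1 : P 1) (i : ZMod 2) : P i := by
  fin_cases i
  exacts [h0, h1]

/-- The grading automorphism, as a linear map. -/
def parityMap : A →ₗ[F] A := GradedAlgebra.proj 𝒜 0 - GradedAlgebra.proj 𝒜 1

/-- Right multiplication by `y` with the sign `(-1) ^ (|y||m|)`, as a bilinear map. -/
def superMulRight : A →ₗ[F] End F A :=
  (LinearMap.mul F A).flip ∘ₗ GradedAlgebra.proj 𝒜 0 +
    ((LinearMap.mul F A).flip ∘ₗ GradedAlgebra.proj 𝒜 1).compl₂ (parityMap 𝒜)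

theorem proj_add_proj (x : A) :
    GradedAlgebra.proj 𝒜 0 x + GradedAlgebra.proj 𝒜 1 x = x := by
  classical
  have h := DirectSum.sum_support_decompose 𝒜 x
  rw [Finset.sum_subset (Finset.subset_univ _) fun i _ hi ↦ by
    rw [DFinsupp.notMem_support_iff.1 hi, ZeroMemClass.coe_zero]] at h
  exact (Fin.sum_univ_two fun i : Fin 2 ↦ ((decompose 𝒜 x (i : ZMod 2) : 𝒜 i) : A)).symm.trans h

theorem proj_mem (i : ZMod 2) (x : A) : GradedAlgebra.proj 𝒜 i x ∈ 𝒜 i :=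
  SetLike.coe_mem _

variable {𝒜}

theorem superHom_induction {P : A → Prop} (hadd : ∀ x y, P x → P y → P (x + y))
    (hom : ∀ i, ∀ x ∈ 𝒜 i, P x) (x : A) : P x := by
  rw [← proj_add_proj 𝒜 x]
  exact hadd _ _ (hom 0 _ (proj_mem 𝒜 0 x)) (hom 1 _ (proj_mem 𝒜 1 x))

theorem proj_of_mem {i : ZMod 2} {x : A} (hx : x ∈ 𝒜 i) : GradedAlgebra.proj 𝒜 i x = x :=
  decompose_of_mem_same 𝒜 hx

theorem proj_of_mem_ne {i j : ZMod 2} {x : A} (hx : x ∈ 𝒜 i) (h : i ≠ j) :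
    GradedAlgebra.proj 𝒜 j x = 0 :=
  decompose_of_mem_ne 𝒜 hx h

theorem parityMap_of_even {x : A} (hx : x ∈ 𝒜 0) : parityMap 𝒜 x = x := by
  simp [parityMap, proj_of_mem hx, proj_of_mem_ne hx (zero_ne_one)]

theorem parityMap_of_odd {x : A} (hx : x ∈ 𝒜 1) : parityMap 𝒜 x = -x := by
  simp [parityMap, proj_of_mem hx, proj_of_mem_ne hx (one_ne_zero)]

theorem superMulRight_of_even {y : A} (hy : y ∈ 𝒜 0) (m : A) :
    superMulRight 𝒜 y m = m * y := by
  simp [superMulRight, proj_of_mem hy, proj_of_mem_ne hy (zero_ne_one)]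

theorem superMulRight_of_odd {y : A} (hy : y ∈ 𝒜 1) (m : A) :
    superMulRight 𝒜 y m = parityMap 𝒜 m * y := by
  simp [superMulRight, proj_of_mem hy, proj_of_mem_ne hy (one_ne_zero)]

theorem mul_mem_of_eq {i j k : ZMod 2} {x y : A} (hx : x ∈ 𝒜 i) (hy : y ∈ 𝒜 j)
    (h : i + j = k) : x * y ∈ 𝒜 k := h ▸ SetLike.mul_mem_graded hx hy

theorem parityMap_parityMap (x : A) : parityMap 𝒜 (parityMap 𝒜 x) = x := by
  induction x using superHom_induction (𝒜 := 𝒜) with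
  | hadd x y hx hy => rw [map_add, map_add, hx, hy]
  | hom i x hx =>
    induction i using ZMod.two_cases with
    | h0 => rw [parityMap_of_even hx, parityMap_of_even hx]
    | h1 => rw [parityMap_of_odd hx, map_neg, parityMap_of_odd hx, neg_neg]

theorem parityMap_mul (x y : A) : parityMap 𝒜 (x * y) = parityMap 𝒜 x * parityMap 𝒜 y := by
  induction x using superHom_induction (𝒜 := 𝒜) with
  | hadd x x' hx hx' => simp only [map_add, add_mul, hx, hx']
  | hom i x hx =>
    induction y using superHom_induction (𝒜 := 𝒜) with
    | hadd y y' hy hy' => simp only [map_add, mul_add, hy, hy']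
    | hom j y hy =>
      induction i using ZMod.two_cases with
      | h0 =>
        induction j using ZMod.two_cases with
        | h0 => rw [parityMap_of_even hx, parityMap_of_even hy,
            parityMap_of_even (mul_mem_of_eq hx hy rfl)]
        | h1 => rw [parityMap_of_even hx, parityMap_of_odd hy,
            parityMap_of_odd (mul_mem_of_eq hx hy rfl), mul_neg]
      | h1 =>
        induction j using ZMod.two_cases with
        | h0 => rw [parityMap_of_odd hx, parityMap_of_even hy,
            parityMap_of_odd (mul_mem_of_eq hx hy rfl), neg_mul]
        | h1 => rw [parityMap_of_odd hx, parityMap_of_odd hy,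
            parityMap_of_even (mul_mem_of_eq hx hy rfl), neg_mul_neg]

theorem parityMap_map (φ : A →ₐ[F] A) (hφ : ∀ (i : ZMod 2), ∀ x ∈ 𝒜 i, φ x ∈ 𝒜 i) (x : A) :
    parityMap 𝒜 (φ x) = φ (parityMap 𝒜 x) := by
  induction x using superHom_induction (𝒜 := 𝒜) with
  | hadd x y hx hy => simp only [map_add, hx, hy]
  | hom i x hx =>
    induction i using ZMod.two_cases with
    | h0 => rw [parityMap_of_even hx, parityMap_of_even (hφ 0 x hx)]
    | h1 => rw [parityMap_of_odd hx, parityMap_of_odd (hφ 1 x hx), map_neg]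

theorem superMulRight_one_apply (m : A) : superMulRight 𝒜 1 m = m := by
  rw [superMulRight_of_even SetLike.GradedOne.one_mem, mul_one]

theorem superMulRight_apply_one (y : A) : superMulRight 𝒜 y 1 = y := by
  have h1 : parityMap 𝒜 1 = 1 := parityMap_of_even SetLike.GradedOne.one_mem
  induction y using superHom_induction (𝒜 := 𝒜) with
  | hadd x y hx hy => rw [map_add, LinearMap.add_apply, hx, hy]
  | hom i y hy =>
    induction i using ZMod.two_cases with
    | h0 => rw [superMulRight_of_even hy, one_mul]
    | h1 => rw [superMulRight_of_odd hy, h1, one_mul]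

theorem superMulRight_superMulRight (y z m : A) :
    superMulRight 𝒜 y (superMulRight 𝒜 z m) = superMulRight 𝒜 (superMulRight 𝒜 y z) m := by
  induction y using superHom_induction (𝒜 := 𝒜) with
  | hadd y y' hy hy' => simp only [map_add, LinearMap.add_apply, hy, hy']
  | hom i y hy =>
    induction z using superHom_induction (𝒜 := 𝒜) with
    | hadd z z' hz hz' => simp only [map_add, LinearMap.add_apply, hz, hz']
    | hom j z hz =>
      induction i using ZMod.two_cases with
      | h0 =>
        induction j using ZMod.two_cases with
        | h0 => simp only [superMulRight_of_even hy, superMulRight_of_even hz,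
            superMulRight_of_even (mul_mem_of_eq hz hy rfl), mul_assoc]
        | h1 => simp only [superMulRight_of_even hy, superMulRight_of_odd hz,
            superMulRight_of_odd (mul_mem_of_eq hz hy rfl), mul_assoc]
      | h1 =>
        induction j using ZMod.two_cases with
        | h0 => simp only [superMulRight_of_odd hy, superMulRight_of_even hz, parityMap_mul,
            parityMap_of_even hz, superMulRight_of_odd (mul_mem_of_eq hz hy rfl), mul_assoc]
        | h1 => simp only [superMulRight_of_odd hy, superMulRight_of_odd hz, parityMap_mul,
            parityMap_of_odd hz, parityMap_parityMap, neg_mul, mul_neg, map_neg,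
            LinearMap.neg_apply,
            superMulRight_of_even (mul_mem_of_eq hz hy rfl), mul_assoc]

theorem parityMap_superMulRight (y m : A) :
    parityMap 𝒜 (superMulRight 𝒜 y m) =
      superMulRight 𝒜 (parityMap 𝒜 y) (parityMap 𝒜 m) := by
  induction y using superHom_induction (𝒜 := 𝒜) with
  | hadd y y' hy hy' => simp only [map_add, LinearMap.add_apply, hy, hy']
  | hom i y hy =>
    induction i using ZMod.two_cases with
    | h0 => simp only [superMulRight_of_even hy, parityMap_of_even hy, parityMap_mul]
    | h1 => simp only [superMulRight_of_odd hy, parityMap_of_odd hy, parityMap_mul, map_neg,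
        LinearMap.neg_apply, mul_neg]

theorem superMulRight_mul (y x m : A) :
    superMulRight 𝒜 y (x * m) = x * superMulRight 𝒜 (GradedAlgebra.proj 𝒜 0 y) m +
      parityMap 𝒜 x * superMulRight 𝒜 (GradedAlgebra.proj 𝒜 1 y) m := by
  conv_lhs => rw [← proj_add_proj 𝒜 y]
  rw [map_add, LinearMap.add_apply, superMulRight_of_even (proj_mem 𝒜 0 y),
    superMulRight_of_odd (proj_mem 𝒜 1 y), superMulRight_of_even (proj_mem 𝒜 0 y),
    superMulRight_of_odd (proj_mem 𝒜 1 y), parityMap_mul, mul_assoc, mul_assoc]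

theorem proj_mul_of_left_mem {i : ZMod 2} {x : A} (hx : x ∈ 𝒜 i) (j : ZMod 2) (y : A) :
    GradedAlgebra.proj 𝒜 (i + j) (x * y) = x * GradedAlgebra.proj 𝒜 j y :=
  coe_decompose_mul_add_of_left_mem 𝒜 hx

theorem proj_mul_of_right_mem {j : ZMod 2} {y : A} (hy : y ∈ 𝒜 j) (i : ZMod 2) (x : A) :
    GradedAlgebra.proj 𝒜 (i + j) (x * y) = GradedAlgebra.proj 𝒜 i x * y :=
  coe_decompose_mul_add_of_right_mem 𝒜 hy

theorem proj_parityMap (d : ZMod 2) (x : A) :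
    GradedAlgebra.proj 𝒜 d (parityMap 𝒜 x) = (-1 : F) ^ d.val • GradedAlgebra.proj 𝒜 d x := by
  have h0 := proj_mem 𝒜 0 x
  have h1 := proj_mem 𝒜 1 x
  rw [parityMap, LinearMap.sub_apply, map_sub]
  induction d using ZMod.two_cases with
  | h0 => rw [proj_of_mem h0, proj_of_mem_ne h1 one_ne_zero]; simp
  | h1 => rw [proj_of_mem h1, proj_of_mem_ne h0 zero_ne_one]; simp [ZMod.val_one]

/-- The homogeneous components of an element intertwining `φ` with the signed right
multiplications are again intertwiners. -/
theorem map_mul_proj_of_intertwine (φ : A →ₐ[F] A)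
    (hφ : ∀ (i : ZMod 2), ∀ x ∈ 𝒜 i, φ x ∈ 𝒜 i) {a : A}
    (ha : ∀ x, φ x * a = superMulRight 𝒜 x a) (d i : ZMod 2) {x : A} (hx : x ∈ 𝒜 i) :
    φ x * GradedAlgebra.proj 𝒜 d a =
      (-1 : F) ^ (d.val * i.val) • (GradedAlgebra.proj 𝒜 d a * x) := by
  rw [← proj_mul_of_left_mem (hφ i x hx), ha, add_comm i d]
  induction i using ZMod.two_cases with
  | h0 => rw [superMulRight_of_even hx, proj_mul_of_right_mem hx]; simp
  | h1 =>
    rw [superMulRight_of_odd hx, proj_mul_of_right_mem hx, proj_parityMap, smul_mul_assoc]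
    simp [ZMod.val_one]

theorem exists_algebraMap_of_intertwine (hcentral : SuperCentral F 𝒜) {a : A}
    (ha : ∀ x, x * a = superMulRight 𝒜 x a) : ∃ c : F, a = algebraMap F A c := by
  have key (d : ZMod 2) : ∃ c : F, GradedAlgebra.proj 𝒜 d a = algebraMap F A c := by
    refine hcentral d _ (proj_mem 𝒜 d a) fun j h hh ↦ ?_
    have := map_mul_proj_of_intertwine (AlgHom.id F A) (fun _ _ hx ↦ hx) ha d j hh
    rw [AlgHom.id_apply] at this
    rw [this, smul_smul, ← mul_pow, neg_one_mul, neg_neg, one_pow, one_smul]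
  obtain ⟨c, hc⟩ := key 0
  obtain ⟨c', hc'⟩ := key 1
  exact ⟨c + c', by rw [map_add, ← hc, ← hc', proj_add_proj]⟩

/-- A graded-simple superalgebra has no proper nonzero subspace stable under the parity map, left
multiplications and signed right multiplications. -/
theorem eq_bot_or_eq_top_of_parity_stable (hchar : (2 : F) ≠ 0) (hsimple : SuperSimple F 𝒜)
    (I : Submodule F A) (hν : ∀ m ∈ I, parityMap 𝒜 m ∈ I) (hl : ∀ x, ∀ m ∈ I, x * m ∈ I)
    (hr : ∀ y, ∀ m ∈ I, superMulRight 𝒜 y m ∈ I) : I = ⊥ ∨ I = ⊤ := by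
  have hr' (y m : A) (hm : m ∈ I) : m * y ∈ I := by
    induction y using superHom_induction (𝒜 := 𝒜) with
    | hadd y y' hy hy' => rw [mul_add]; exact I.add_mem hy hy'
    | hom i y hy =>
      induction i using ZMod.two_cases with
      | h0 => rw [← superMulRight_of_even hy]; exact hr _ _ hm
      | h1 =>
        rw [← parityMap_parityMap (𝒜 := 𝒜) m, ← superMulRight_of_odd hy]
        exact hr _ _ (hν _ hm)
  let J : TwoSidedIdeal A := .mk' I I.zero_mem I.add_mem I.neg_mem
    (fun {x y} h ↦ hl x y h) (fun {x y} h ↦ hr' y x h)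
  have hJ (x : A) : x ∈ J ↔ x ∈ I := TwoSidedIdeal.mem_mk' ..
  have hproj (x : A) (hx : x ∈ I) : GradedAlgebra.proj 𝒜 0 x ∈ I := by
    have : (2 : F) • GradedAlgebra.proj 𝒜 0 x = x + parityMap 𝒜 x := by
      nth_rw 2 [← proj_add_proj 𝒜 x]
      rw [parityMap, LinearMap.sub_apply, two_smul]
      abel
    exact (I.smul_mem_iff hchar).1 (this ▸ I.add_mem hx (hν x hx))
  have hgr : ∀ x ∈ J, ∀ i : ZMod 2, ((decompose 𝒜 x i : 𝒜 i) : A) ∈ J := by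
    intro x hx i
    rw [hJ] at hx ⊢
    change GradedAlgebra.proj 𝒜 i x ∈ I
    induction i using ZMod.two_cases with
    | h0 => exact hproj x hx
    | h1 =>
      rw [eq_sub_of_add_eq' (proj_add_proj 𝒜 x)]
      exact I.sub_mem hx (hproj x hx)
  refine (hsimple.2 J hgr).imp (fun h ↦ ?_) (fun h ↦ ?_)
  · ext x
    rw [← hJ, h, TwoSidedIdeal.mem_bot, Submodule.mem_bot]
  · ext x
    simp [← hJ, h]

/-- A central simple superalgebra has no proper nonzero subspace stable under left multiplications
and signed right multiplications. -/
theorem eq_bot_or_eq_top_of_stable (hchar : (2 : F) ≠ 0) (hcentral : SuperCentral F 𝒜)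
    (hsimple : SuperSimple F 𝒜)
    (I : Submodule F A) (hl : ∀ x, ∀ m ∈ I, x * m ∈ I)
    (hr : ∀ y, ∀ m ∈ I, superMulRight 𝒜 y m ∈ I) : I = ⊥ ∨ I = ⊤ := by
  have htop {I : Submodule F A} (hl : ∀ x, ∀ m ∈ I, x * m ∈ I) (h1 : (1 : A) ∈ I) : I = ⊤ :=
    Submodule.eq_top_iff'.2 fun x ↦ by simpa using hl x 1 h1
  let I' := I.comap (parityMap 𝒜)
  have hl' (x m : A) (hm : m ∈ I') : x * m ∈ I' := by
    change parityMap 𝒜 _ ∈ I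
    rw [parityMap_mul]
    exact hl _ _ hm
  have hr' (y m : A) (hm : m ∈ I') : superMulRight 𝒜 y m ∈ I' := by
    change parityMap 𝒜 _ ∈ I
    rw [parityMap_superMulRight]
    exact hr _ _ hm
  have hν (m : A) (hm : m ∈ I) : parityMap 𝒜 m ∈ I' := by
    change parityMap 𝒜 _ ∈ I
    rwa [parityMap_parityMap]
  rcases eq_bot_or_eq_top_of_parity_stable hchar hsimple (I ⊓ I') (fun m hm ↦ ⟨hm.2, hν m hm.1⟩)
    (fun x m hm ↦ ⟨hl x m hm.1, hl' x m hm.2⟩) (fun y m hm ↦ ⟨hr y m hm.1, hr' y m hm.2⟩)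
    with hinf | hinf
  swap
  · exact .inr (top_le_iff.1 (hinf ▸ inf_le_left))
  rcases eq_bot_or_eq_top_of_parity_stable hchar hsimple (I ⊔ I')
    (fun m hm ↦ by
      obtain ⟨u, hu, v, hv, rfl⟩ := Submodule.mem_sup.1 hm
      rw [map_add, add_comm]
      exact Submodule.add_mem_sup hv (hν u hu))
    (fun x m hm ↦ by
      obtain ⟨u, hu, v, hv, rfl⟩ := Submodule.mem_sup.1 hm
      rw [mul_add]
      exact Submodule.add_mem_sup (hl x u hu) (hl' x v hv))
    (fun y m hm ↦ by
      obtain ⟨u, hu, v, hv, rfl⟩ := Submodule.mem_sup.1 hm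
      rw [map_add]
      exact Submodule.add_mem_sup (hr y u hu) (hr' y v hv))
    with hsup | hsup
  · exact .inl (le_bot_iff.1 (hsup ▸ le_sup_left))
  obtain ⟨e, he, f, hf, hef⟩ := Submodule.mem_sup.1 (hsup ▸ Submodule.mem_top : (1 : A) ∈ I ⊔ I')
  obtain ⟨c, hc⟩ := exists_algebraMap_of_intertwine hcentral (a := e) fun x ↦ by
    have h : x * e - superMulRight 𝒜 x e = superMulRight 𝒜 x f - x * f := by
      rw [sub_eq_sub_iff_add_eq_add, ← mul_add, add_comm _ (superMulRight 𝒜 x e), ← map_add, hef,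
        mul_one, superMulRight_apply_one]
    have hmem : x * e - superMulRight 𝒜 x e ∈ I ⊓ I' :=
      ⟨I.sub_mem (hl x e he) (hr x e he), h ▸ I'.sub_mem (hr' x f hf) (hl' x f hf)⟩
    rw [hinf, Submodule.mem_bot] at hmem
    exact sub_eq_zero.1 hmem
  right
  by_cases hc0 : c = 0
  · have hf1 : f = 1 := by rw [← hef, hc, hc0, map_zero, zero_add]
    have h1 := hν _ (htop (I := I') hl' (hf1 ▸ hf) ▸ Submodule.mem_top : (1 : A) ∈ I')
    have h2 : parityMap 𝒜 1 ∈ I := hf1 ▸ hf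
    rw [parityMap_of_even SetLike.GradedOne.one_mem] at h2
    exact htop hl h2
  · refine htop hl ?_
    rw [hc, Algebra.algebraMap_eq_smul_one] at he
    exact (I.smul_mem_iff hc0).1 he

variable (𝒜) in
/-- The operator `m ↦ (-1) ^ (|y||m|) x m y`, as a linear map on the tensor square. -/
def superMulLeftRight : A ⊗[F] A →ₗ[F] End F A :=
  TensorProduct.lift ((LinearMap.mul F (End F A)).compl₁₂ (LinearMap.mul F A) (superMulRight 𝒜))

theorem superMulLeftRight_tmul (x y m : A) :
    superMulLeftRight 𝒜 (x ⊗ₜ y) m = x * superMulRight 𝒜 y m := rfl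

theorem superMulLeftRight_one : superMulLeftRight 𝒜 (1 ⊗ₜ 1) = 1 := by
  ext m
  rw [superMulLeftRight_tmul, superMulRight_one_apply, one_mul, End.one_apply]

/-- The operators `superMulLeftRight` are closed under composition, compatibly with twisting the
left factor by a graded endomorphism. -/
theorem exists_superMulLeftRight_mul (φ : A →ₐ[F] A)
    (hφ : ∀ (i : ZMod 2), ∀ x ∈ 𝒜 i, φ x ∈ 𝒜 i) (z z' : A ⊗[F] A) :
    ∃ w, superMulLeftRight 𝒜 z * superMulLeftRight 𝒜 z' = superMulLeftRight 𝒜 w ∧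
      superMulLeftRight 𝒜 (φ.toLinearMap.rTensor A z) *
        superMulLeftRight 𝒜 (φ.toLinearMap.rTensor A z') =
      superMulLeftRight 𝒜 (φ.toLinearMap.rTensor A w) := by
  induction z with
  | zero => exact ⟨0, by simp⟩
  | add z₁ z₂ h₁ h₂ =>
    obtain ⟨w₁, h₁, h₁'⟩ := h₁
    obtain ⟨w₂, h₂, h₂'⟩ := h₂
    exact ⟨w₁ + w₂, by simp only [map_add, add_mul, h₁, h₂], by
      simp only [map_add, add_mul, h₁', h₂']⟩
  | tmul x y =>
    induction z' with
    | zero => exact ⟨0, by simp⟩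
    | add z₁ z₂ h₁ h₂ =>
      obtain ⟨w₁, h₁, h₁'⟩ := h₁
      obtain ⟨w₂, h₂, h₂'⟩ := h₂
      exact ⟨w₁ + w₂, by simp only [map_add, mul_add, h₁, h₂], by
        simp only [map_add, mul_add, h₁', h₂']⟩
    | tmul x' y' =>
      refine ⟨(x * x') ⊗ₜ superMulRight 𝒜 (GradedAlgebra.proj 𝒜 0 y) y' +
        (x * parityMap 𝒜 x') ⊗ₜ superMulRight 𝒜 (GradedAlgebra.proj 𝒜 1 y) y', ?_, ?_⟩
      · ext m
        simp only [End.mul_apply, map_add, LinearMap.add_apply, superMulLeftRight_tmul,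
          superMulRight_mul y, superMulRight_superMulRight, mul_add, mul_assoc]
      · ext m
        simp only [End.mul_apply, map_add, LinearMap.add_apply, LinearMap.rTensor_tmul,
          AlgHom.toLinearMap_apply, map_mul, superMulLeftRight_tmul,
          superMulRight_mul y, superMulRight_superMulRight, parityMap_map φ hφ, mul_add, mul_assoc]

theorem superMulLeftRight_surjective (hchar : (2 : F) ≠ 0) (hfin : FiniteDimensional F A)
    (hcentral : SuperCentral F 𝒜) (hsimple : SuperSimple F 𝒜) :
    Function.Surjective (superMulLeftRight 𝒜) := by
  let S : Subalgebra F (End F A) :=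
    (LinearMap.range (superMulLeftRight 𝒜)).toSubalgebra ⟨_, superMulLeftRight_one (𝒜 := 𝒜)⟩ (by
      rintro _ _ ⟨z, rfl⟩ ⟨z', rfl⟩
      obtain ⟨w, hw, -⟩ := exists_superMulLeftRight_mul (𝒜 := 𝒜) (AlgHom.id F A) (fun _ _ h ↦ h) z z'
      exact ⟨w, hw.symm⟩)
  let L (x : A) : S := ⟨superMulLeftRight 𝒜 (x ⊗ₜ 1), _, rfl⟩
  let R (y : A) : S := ⟨superMulLeftRight 𝒜 (1 ⊗ₜ y), _, rfl⟩
  have hL (x m : A) : L x • m = x * m := by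
    change superMulLeftRight 𝒜 (x ⊗ₜ 1) m = _
    rw [superMulLeftRight_tmul, superMulRight_one_apply]
  have hR (y m : A) : R y • m = superMulRight 𝒜 y m := by
    change superMulLeftRight 𝒜 (1 ⊗ₜ y) m = _
    rw [superMulLeftRight_tmul, one_mul]
  obtain ⟨x₀, hx₀⟩ := hsimple.1
  have : Nontrivial A := ⟨x₀, 0, hx₀⟩
  have : IsSimpleModule S A :=
    { eq_bot_or_eq_top := fun N ↦ by
        have h := eq_bot_or_eq_top_of_stable hchar hcentral hsimple (N.restrictScalars F)
          (fun x m hm ↦ hL x m ▸ N.smul_mem (L x) hm) (fun y m hm ↦ hR y m ▸ N.smul_mem (R y) hm)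
        simpa using h }
  have hend (g : End S A) : ∃ c : F, ∀ m, g m = c • m := by
    have h1 (x : A) : g x = x * g 1 := by rw [← hL, ← map_smul, hL, mul_one]
    obtain ⟨c, hc⟩ := exists_algebraMap_of_intertwine hcentral (a := g 1) fun x ↦ by
      rw [← h1, ← hR, ← map_smul, hR, superMulRight_apply_one]
    exact ⟨c, fun m ↦ by rw [h1, hc, ← Algebra.commutes, Algebra.smul_def]⟩
  intro T
  let T' : End (End S A) A :=
    { toFun := T
      map_add' := T.map_add
      map_smul' := fun g m ↦ by
        obtain ⟨c, hc⟩ := hend g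
        simp only [End.smul_def, hc, map_smul, RingHom.id_apply] }
  obtain ⟨s, hs⟩ := (Module.finite_def (R := F) (M := A)).1 hfin
  obtain ⟨⟨_, z, rfl⟩, hr⟩ := jacobson_density (R := S) T' s
  exact ⟨z, LinearMap.ext_on hs fun m hm ↦ (hr m hm).symm⟩

/-- A graded automorphism of a central simple superalgebra admits a nonzero intertwiner. -/
theorem exists_intertwine (hchar : (2 : F) ≠ 0) (hfin : FiniteDimensional F A)
    (hcentral : SuperCentral F 𝒜) (hsimple : SuperSimple F 𝒜)
    (φ : A ≃ₐ[F] A) (hφ : ∀ (i : ZMod 2), ∀ x ∈ 𝒜 i, φ x ∈ 𝒜 i) :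
    ∃ a : A, a ≠ 0 ∧ ∀ x, φ x * a = superMulRight 𝒜 x a := by
  have hsurj := superMulLeftRight_surjective hchar hfin hcentral hsimple
  have hinj : Function.Injective (superMulLeftRight 𝒜) :=
    (LinearMap.injective_iff_surjective_of_finrank_eq_finrank
      (by rw [finrank_tensorProduct, finrank_linearMap])).2 hsurj
  let T := LinearEquiv.ofBijective (superMulLeftRight 𝒜) ⟨hinj, hsurj⟩
  let Θ : End F A ≃ₗ[F] End F A := T.symm ≪≫ₗ φ.toLinearEquiv.rTensor A ≪≫ₗ T
  have hΘ (z : A ⊗[F] A) : Θ (superMulLeftRight 𝒜 z) =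
      superMulLeftRight 𝒜 ((φ : A →ₐ[F] A).toLinearMap.rTensor A z) := by
    change T ((φ.toLinearEquiv.rTensor A) (T.symm (T z))) = _
    rw [T.symm_apply_apply]
    rfl
  have hΘ1 : Θ 1 = 1 := by
    rw [← superMulLeftRight_one (𝒜 := 𝒜), hΘ]
    simp
  have hΘmul (f g : End F A) : Θ (f * g) = Θ f * Θ g := by
    obtain ⟨z, rfl⟩ := hsurj f
    obtain ⟨z', rfl⟩ := hsurj g
    obtain ⟨w, hw, hw'⟩ := exists_superMulLeftRight_mul (φ : A →ₐ[F] A) hφ z z'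
    rw [hw, hΘ, hΘ, hΘ, hw']
  obtain ⟨U, hU⟩ := (AlgEquiv.ofLinearEquiv Θ hΘ1 hΘmul).eq_linearEquivConjAlgEquiv
  have hU' (z : A ⊗[F] A) (m : A) : U (superMulLeftRight 𝒜 z m) =
      superMulLeftRight 𝒜 ((φ : A →ₐ[F] A).toLinearMap.rTensor A z) (U m) := by
    rw [← hΘ]
    have := congr($hU (superMulLeftRight 𝒜 z) (U m))
    simp [LinearEquiv.conjAlgEquiv_apply] at this
    exact this.symm
  obtain ⟨x₀, hx₀⟩ := hsimple.1
  have : Nontrivial A := ⟨x₀, 0, hx₀⟩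
  refine ⟨U 1, by simp, fun x ↦ ?_⟩
  have h1 := hU' (x ⊗ₜ 1) 1
  have h2 := hU' (1 ⊗ₜ x) 1
  simp only [superMulLeftRight_tmul, superMulRight_apply_one, LinearMap.rTensor_tmul,
    superMulRight_one_apply, AlgHom.toLinearMap_apply, map_one, one_mul, mul_one] at h1 h2
  exact h1.symm.trans h2

theorem isUnit_of_intertwine (hchar : (2 : F) ≠ 0) (hfin : FiniteDimensional F A)
    (hcentral : SuperCentral F 𝒜) (hsimple : SuperSimple F 𝒜)
    (φ : A →ₐ[F] A) {a : A} (ha0 : a ≠ 0) (ha : ∀ x, φ x * a = superMulRight 𝒜 x a) :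
    IsUnit a := by
  let f : A →ₗ[F] A := LinearMap.mulRight F a ∘ₗ φ.toLinearMap
  have hf (x : A) : f x = φ x * a := rfl
  have hker : LinearMap.ker f = ⊥ := by
    refine (eq_bot_or_eq_top_of_stable hchar hcentral hsimple (LinearMap.ker f)
      (fun x m hm ↦ ?_) (fun y m hm ↦ ?_)).resolve_right fun h ↦ ha0 ?_
    · rw [LinearMap.mem_ker, hf] at hm ⊢
      rw [map_mul, mul_assoc, hm, mul_zero]
    · rw [LinearMap.mem_ker, hf] at hm ⊢
      rw [ha, ← superMulRight_superMulRight, ← ha, hm, map_zero]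
    · have h1 : (1 : A) ∈ LinearMap.ker f := h ▸ Submodule.mem_top
      simpa [hf] using h1
  obtain ⟨x, hx⟩ := LinearMap.surjective_of_injective (LinearMap.ker_eq_bot.1 hker) 1
  rw [hf] at hx
  have h2 : LinearMap.mulLeft F (φ x) * LinearMap.mulLeft F a = 1 := by
    ext m
    rw [End.mul_apply, LinearMap.mulLeft_apply, LinearMap.mulLeft_apply, ← mul_assoc, hx, one_mul,
      End.one_apply]
  have h3 := congr($(mul_eq_one_comm.1 h2) 1)
  exact ⟨⟨a, φ x, by simpa using h3, hx⟩, rfl⟩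

theorem inv_mem_even {a : Aˣ} (ha : (a : A) ∈ 𝒜 0) : ((a⁻¹ : Aˣ) : A) ∈ 𝒜 0 := by
  have h := proj_mul_of_left_mem ha 0 ((a⁻¹ : Aˣ) : A)
  rw [a.mul_inv, add_zero, proj_of_mem SetLike.GradedOne.one_mem] at h
  rw [Units.inv_eq_of_mul_eq_one_right h.symm]
  exact proj_mem 𝒜 0 _

end GradedSkolemNoether

/-- **Graded Skolem–Noether.**  Every graded automorphism of a central simple superalgebra
is inner (given by a homogeneous unit `a` via `x ↦ (-1)^{|a||x|} a x a⁻¹`), and no graded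
automorphism is simultaneously inner for an even unit and for an odd unit. -/
theorem graded_skolem_noether
    (F : Type*) {A : Type*} [Field F] [Ring A] [Algebra F A]
    (hchar : (2 : F) ≠ 0)
    (𝒜 : ZMod 2 → Submodule F A) [GradedAlgebra 𝒜]
    (hfin : FiniteDimensional F A)
    (hcentral : SuperCentral F 𝒜)
    (hsimple : SuperSimple F 𝒜)
    (φ : A ≃ₐ[F] A) (hφ : ∀ (i : ZMod 2), ∀ x ∈ 𝒜 i, φ x ∈ 𝒜 i) :
    (∃ (d : ZMod 2) (a : Aˣ), (a : A) ∈ 𝒜 d ∧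
      ∀ (i : ZMod 2), ∀ x ∈ 𝒜 i,
        φ x = ((-1 : F) ^ (d.val * i.val)) • ((a : A) * x * ((a⁻¹ : Aˣ) : A))) ∧
    ¬ ((∃ a : Aˣ, (a : A) ∈ 𝒜 0 ∧ ∀ (i : ZMod 2), ∀ x ∈ 𝒜 i,
          φ x = ((-1 : F) ^ ((0 : ZMod 2).val * i.val)) • ((a : A) * x * ((a⁻¹ : Aˣ) : A))) ∧
       (∃ a : Aˣ, (a : A) ∈ 𝒜 1 ∧ ∀ (i : ZMod 2), ∀ x ∈ 𝒜 i,
          φ x = ((-1 : F) ^ ((1 : ZMod 2).val * i.val)) • ((a : A) * x * ((a⁻¹ : Aˣ) : A)))) := by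
  constructor
  · obtain ⟨a, ha0, ha⟩ := exists_intertwine hchar hfin hcentral hsimple φ hφ
    obtain ⟨d, hd⟩ : ∃ d, GradedAlgebra.proj 𝒜 d a ≠ 0 := by
      by_contra! h
      exact ha0 (by rw [← proj_add_proj 𝒜 a, h, h, add_zero])
    have key (i : ZMod 2) (x : A) (hx : x ∈ 𝒜 i) :=
      map_mul_proj_of_intertwine (φ : A →ₐ[F] A) hφ ha d i hx
    have hmem := proj_mem 𝒜 d a
    generalize GradedAlgebra.proj 𝒜 d a = b at hd key hmem
    have hb : ∀ x, (φ : A →ₐ[F] A) x * b = superMulRight 𝒜 x b := fun x ↦ by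
      induction x using superHom_induction (𝒜 := 𝒜) with
      | hadd x y hx hy => rw [map_add, add_mul, hx, hy, map_add, LinearMap.add_apply]
      | hom i x hx =>
        rw [key i x hx]
        induction i using ZMod.two_cases with
        | h0 => simp [superMulRight_of_even hx]
        | h1 =>
          rw [superMulRight_of_odd hx]
          induction d using ZMod.two_cases with
          | h0 => simp [parityMap_of_even hmem]
          | h1 => simp [parityMap_of_odd hmem, ZMod.val_one]
    obtain ⟨u, rfl⟩ := isUnit_of_intertwine hchar hfin hcentral hsimple (φ : A →ₐ[F] A) hd hb
    refine ⟨d, u, hmem, fun i x hx ↦ ?_⟩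
    rw [← smul_mul_assoc, Units.eq_mul_inv_iff_mul_eq]
    exact key i x hx
  · rintro ⟨⟨a, ha, haφ⟩, b, hb, hbφ⟩
    have hc : ((a⁻¹ : Aˣ) : A) * b ∈ 𝒜 1 := mul_mem_of_eq (inv_mem_even ha) hb rfl
    obtain ⟨c, hcF⟩ := hcentral 1 _ hc fun j x hx ↦ by
      have h := (haφ j x hx).symm.trans (hbφ j x hx)
      rw [← smul_mul_assoc _ _ ((b⁻¹ : Aˣ) : A), Units.eq_mul_inv_iff_mul_eq, ZMod.val_zero,
        zero_mul, pow_zero, one_smul] at h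
      have h' : x * (((a⁻¹ : Aˣ) : A) * b) =
          (-1 : F) ^ ((1 : ZMod 2).val * j.val) • (((a⁻¹ : Aˣ) : A) * b * x) := by
        rw [mul_assoc _ (b : A), ← mul_smul_comm, ← h]
        simp [mul_assoc]
      rw [h', smul_smul, ← mul_pow, neg_one_mul, neg_neg, one_pow, one_smul]
    have h0 : ((a⁻¹ : Aˣ) : A) * b = 0 := by
      rw [← proj_of_mem hc, hcF]
      exact proj_of_mem_ne (SetLike.algebraMap_mem_graded 𝒜 c) zero_ne_one
    obtain ⟨x, hx⟩ := hsimple.1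
    have : Nontrivial A := ⟨x, 0, hx⟩
    exact (a⁻¹ * b).ne_zero (by rw [Units.val_mul, h0])
end

section
/- Let A be a central simple superalgebra of odd type over F. Then A has an F-linear superantiautomorphism if and only if the following two conditions hold: (1) −1 is a square in F, and (2) the algebra A₀ has an F-linear antiautomorphism. -/
/-- The even part `A₀` of a superalgebra, as a subalgebra. -/
def evenPart (F : Type*) {A : Type*} [Field F] [Ring A] [Algebra F A]
    (𝒜 : ZMod 2 → Submodule F A) [GradedAlgebra 𝒜] : Subalgebra F A :=
  Submodule.toSubalgebra (𝒜 0) (SetLike.one_mem_graded 𝒜)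
    (fun x y hx hy => by simpa using SetLike.mul_mem_graded hx hy)

section OddSuperalgebra

variable {F A : Type*} [Field F] [Ring A] [Algebra F A]
variable {𝒜 : ZMod 2 → Submodule F A}

/-- An even element that commutes with everything is a scalar. -/
theorem SuperCentral.exists_eq_algebraMap (hcentral : SuperCentral F 𝒜) {x : A} (hx : x ∈ 𝒜 0)
    (hxc : ∀ y, x * y = y * x) : ∃ c : F, x = algebraMap F A c :=
  hcentral 0 x hx fun j h _ => by simp [hxc h]

variable [GradedAlgebra 𝒜]

/-- In a graded-simple superalgebra, a nonzero homogeneous central element is left regular. -/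
theorem eq_zero_of_central_homogeneous_mul_eq_zero (hsimple : SuperSimple F 𝒜) {i : ZMod 2} {z : A}
    (hz0 : z ≠ 0) (hz : z ∈ 𝒜 i) (hzc : ∀ y, z * y = y * z) {x : A} (hx : z * x = 0) : x = 0 := by
  let I : TwoSidedIdeal A := TwoSidedIdeal.mk' {x | z * x = 0} (by simp)
    (fun {x y} hx hy => by
      simp only [Set.mem_ofPred_eq] at *
      rw [mul_add, hx, hy, add_zero])
    (fun {x} hx => by
      simp only [Set.mem_ofPred_eq] at *
      rw [mul_neg, hx, neg_zero])
    (fun {x y} hy => by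
      simp only [Set.mem_ofPred_eq] at *
      rw [← mul_assoc, hzc, mul_assoc, hy, mul_zero])
    (fun {x y} hx => by
      simp only [Set.mem_ofPred_eq] at *
      rw [← mul_assoc, hx, zero_mul])
  have mem_I (x : A) : x ∈ I ↔ z * x = 0 := by simp [I, TwoSidedIdeal.mem_mk']
  rcases hsimple.2 I fun x hx j => by
    rw [mem_I] at hx ⊢
    rw [← DirectSum.coe_decompose_mul_add_of_left_mem 𝒜 hz, hx]
    simp with h | h
  · have : x ∈ I := (mem_I x).2 hx
    rwa [h, TwoSidedIdeal.mem_bot] at this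
  · have : (1 : A) ∈ I := h ▸ trivial
    rw [mem_I, mul_one] at this
    exact absurd this hz0

/-- The square of a nonzero odd central element is a nonzero scalar. -/
theorem exists_mul_self_eq_algebraMap (hcentral : SuperCentral F 𝒜) (hsimple : SuperSimple F 𝒜)
    {z : A} (hz0 : z ≠ 0) (hz : z ∈ 𝒜 1) (hzc : ∀ y, z * y = y * z) :
    ∃ c : F, c ≠ 0 ∧ z * z = algebraMap F A c := by
  obtain ⟨c, hc⟩ := hcentral.exists_eq_algebraMap (x := z * z) (SetLike.mul_mem_graded hz hz)
    fun y => by rw [mul_assoc, hzc y, ← mul_assoc, hzc y, mul_assoc]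
  refine ⟨c, ?_, hc⟩
  rintro rfl
  exact hz0 (eq_zero_of_central_homogeneous_mul_eq_zero hsimple hz0 hz hzc (by simpa using hc))

/-- `A = A₀ ⊕ z A₀` for an odd element `z` whose square is a nonzero scalar. -/
theorem bijective_evenPart_prod {z : A} (hz : z ∈ 𝒜 1) {c : F} (hc : c ≠ 0)
    (hzz : z * z = algebraMap F A c) :
    Function.Bijective ((evenPart F 𝒜).val.toLinearMap.coprod
      (LinearMap.mulLeft F z ∘ₗ (evenPart F 𝒜).val.toLinearMap)) := by
  classical
  have hz_mul (x : A) : z * (c⁻¹ • (z * x)) = x := by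
    rw [mul_smul_comm, ← mul_assoc, hzz, ← Algebra.smul_def, smul_smul, inv_mul_cancel₀ hc,
      one_smul]
  constructor
  · rw [← LinearMap.ker_eq_bot, LinearMap.ker_eq_bot']
    rintro ⟨a, b⟩ h
    have ha : (a : A) ∈ 𝒜 0 := a.2
    have hzb : z * (b : A) ∈ 𝒜 1 := SetLike.mul_mem_graded (i := (1 : ZMod 2)) (j := 0) hz b.2
    have h' : (a : A) + z * b = 0 := h
    have ha0 : (a : A) = 0 := by
      have := congrArg (fun x => ((DirectSum.decompose 𝒜 x 0 : 𝒜 0) : A)) h'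
      simpa only [DirectSum.decompose_add, DirectSum.add_apply, Submodule.coe_add,
        DirectSum.decompose_of_mem_same 𝒜 ha,
        DirectSum.decompose_of_mem_ne 𝒜 hzb (show (1 : ZMod 2) ≠ 0 by decide), add_zero,
        DirectSum.decompose_zero, DirectSum.zero_apply, Submodule.coe_zero] using this
    have hb0 : (b : A) = 0 := by
      rw [ha0, zero_add] at h'
      have h2 : z * (c⁻¹ • (z * (b : A))) = 0 := by rw [h']; simp
      rwa [hz_mul] at h2
    exact Prod.ext (Subtype.ext ha0) (Subtype.ext hb0)
  · intro x
    refine ⟨⟨⟨DirectSum.decompose 𝒜 x 0, SetLike.coe_mem _⟩,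
      ⟨c⁻¹ • (z * DirectSum.decompose 𝒜 x 1), Submodule.smul_mem _ _
        (SetLike.mul_mem_graded (i := (1 : ZMod 2)) (j := 1) hz (SetLike.coe_mem _))⟩⟩, ?_⟩
    change (DirectSum.decompose 𝒜 x 0 : A) + z * (c⁻¹ • (z * DirectSum.decompose 𝒜 x 1)) = x
    rw [hz_mul]
    conv_rhs => rw [← DirectSum.sum_support_decompose 𝒜 x]
    rw [Finset.sum_subset (Finset.subset_univ _) (fun i _ hi => by simpa using hi)]
    exact (Fin.sum_univ_two (fun i : Fin 2 => (DirectSum.decompose 𝒜 x i : A))).symm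

/-- A superantiautomorphism multiplies a nonzero odd central element by a square root of `-1`. -/
theorem IsSuperAntiAuto.exists_sq_eq_neg_one (hcentral : SuperCentral F 𝒜) {σ : A ≃ₗ[F] A}
    (hσ : IsSuperAntiAuto F 𝒜 σ) {z : A} (hz : z ∈ 𝒜 1) (hzc : ∀ y, z * y = y * z)
    {c : F} (hc : c ≠ 0) (hzz : z * z = algebraMap F A c) (hA : ∃ x : A, x ≠ 0) :
    ∃ s : F, s ^ 2 = -1 := by
  classical
  have : Nontrivial A := by
    obtain ⟨x, hx⟩ := hA
    exact ⟨x, 0, hx⟩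
  have hσz : σ z ∈ 𝒜 1 := hσ.1 1 z hz
  have comm_hom (j : ZMod 2) (y : A) (hy : y ∈ 𝒜 j) : σ z * σ y = σ y * σ z := by
    have h1 := hσ.2 1 j z hz y hy
    rw [hzc, hσ.2 j 1 y hy z hz, mul_comm j.val] at h1
    exact smul_right_injective A (pow_ne_zero _ (neg_ne_zero.2 one_ne_zero)) h1
  have comm (y : A) : σ z * y = y * σ z := by
    obtain ⟨y, rfl⟩ := σ.surjective y
    rw [← DirectSum.sum_support_decompose 𝒜 y, map_sum, Finset.mul_sum, Finset.sum_mul]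
    exact Finset.sum_congr rfl fun i _ => comm_hom i _ (SetLike.coe_mem _)
  obtain ⟨d, hd⟩ := hcentral.exists_eq_algebraMap (x := z * σ z) (SetLike.mul_mem_graded hz hσz)
    fun y => by rw [mul_assoc, comm y, ← mul_assoc, hzc y, mul_assoc]
  have hσ1 : σ 1 = 1 := by
    have mul_one_image (y : A) : σ y * σ 1 = σ y := by
      rw [← DirectSum.sum_support_decompose 𝒜 y, map_sum, Finset.sum_mul]
      refine Finset.sum_congr rfl fun i _ => ?_
      simpa using (hσ.2 0 i 1 (SetLike.one_mem_graded 𝒜) _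
        (SetLike.coe_mem (DirectSum.decompose 𝒜 y i))).symm
    obtain ⟨e, he⟩ := σ.surjective 1
    simpa [he] using mul_one_image e
  have hsq : algebraMap F A c = -(σ z * σ z) := by
    have := hσ.2 1 1 z hz z hz
    rw [hzz, Algebra.algebraMap_eq_smul_one, map_smul, hσ1] at this
    simpa [Algebra.algebraMap_eq_smul_one, ZMod.val_one] using this
  have hdd : algebraMap F A (d * d) = algebraMap F A (-(c * c)) := by
    have : z * σ z * (z * σ z) = z * z * (σ z * σ z) := by
      rw [mul_assoc, ← mul_assoc (σ z), comm z]; simp only [mul_assoc]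
    rw [hd, hzz, ← neg_neg (σ z * σ z), ← hsq] at this
    simpa using this
  have hdd' : d * d = -(c * c) := (algebraMap F A).injective hdd
  exact ⟨d / c, by field_simp; linear_combination hdd'⟩

/-- The map `a + z b ↦ ψ a + s z ψ b` built from an antiautomorphism `ψ` of the even part and a
square root `s` of `-1` is a superantiautomorphism. -/
theorem exists_isSuperAntiAuto_of_evenPart {z : A} (hz : z ∈ 𝒜 1) (hzc : ∀ y, z * y = y * z)
    {c : F} (hc : c ≠ 0) (hzz : z * z = algebraMap F A c) {s : F} (hs : s ^ 2 = -1)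
    (ψ : evenPart F 𝒜 ≃ₗ[F] evenPart F 𝒜) (hψ : ∀ x y, ψ (x * y) = ψ y * ψ x) :
    ∃ σ : A ≃ₗ[F] A, IsSuperAntiAuto F 𝒜 σ := by
  have hs0 : s ≠ 0 := by
    rintro rfl
    simp at hs
  let E := LinearEquiv.ofBijective _ (bijective_evenPart_prod (𝒜 := 𝒜) hz hc hzz)
  have E_apply (a b : evenPart F 𝒜) : E (a, b) = a + z * b := rfl
  let σ : A ≃ₗ[F] A := E.symm ≪≫ₗ
    (ψ.prodCongr (ψ ≪≫ₗ LinearEquiv.smulOfNeZero F (evenPart F 𝒜) s hs0)) ≪≫ₗ E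
  have σ_E (a b : evenPart F 𝒜) : σ (E (a, b)) = ψ a + s • (z * ψ b) := by
    rw [LinearEquiv.trans_apply, LinearEquiv.trans_apply, LinearEquiv.symm_apply_apply,
      LinearEquiv.prodCongr_apply, E_apply]
    simp
  have σ_even (a : evenPart F 𝒜) : σ a = ψ a := by
    simpa [E_apply] using σ_E a 0
  have σ_odd (b : evenPart F 𝒜) : σ (z * b) = s • (z * ψ b) := by
    simpa [E_apply] using σ_E 0 b
  have exists_even (x : A) (hx : x ∈ 𝒜 0) : ∃ a : evenPart F 𝒜, x = a := ⟨⟨x, hx⟩, rfl⟩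
  have exists_odd (x : A) (hx : x ∈ 𝒜 1) : ∃ b : evenPart F 𝒜, x = z * b := by
    refine ⟨⟨c⁻¹ • (z * x), Submodule.smul_mem _ _
      (SetLike.mul_mem_graded (i := (1 : ZMod 2)) (j := 1) hz hx)⟩, ?_⟩
    change x = z * (c⁻¹ • (z * x))
    rw [mul_smul_comm, ← mul_assoc, hzz, ← Algebra.smul_def, smul_smul, inv_mul_cancel₀ hc,
      one_smul]
  have ψ_mul (a b : evenPart F 𝒜) : (ψ (a * b) : A) = ψ b * ψ a := by rw [hψ]; rfl
  have zmod_two (i : ZMod 2) : i = 0 ∨ i = 1 := by revert i; decide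
  refine ⟨σ, fun i x hx => ?_, fun i j x hx y hy => ?_⟩
  · rcases zmod_two i with rfl | rfl
    · obtain ⟨a, rfl⟩ := exists_even x hx
      rw [σ_even]
      exact (ψ a).2
    · obtain ⟨b, rfl⟩ := exists_odd x hx
      rw [σ_odd]
      exact Submodule.smul_mem _ _
        (SetLike.mul_mem_graded (i := (1 : ZMod 2)) (j := 0) hz (ψ b).2)
  · rcases zmod_two i with rfl | rfl <;> rcases zmod_two j with rfl | rfl
    · obtain ⟨a, rfl⟩ := exists_even x hx
      obtain ⟨b, rfl⟩ := exists_even y hy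
      rw [σ_even, σ_even, ← ψ_mul, ← σ_even]
      simp
    · obtain ⟨a, rfl⟩ := exists_even x hx
      obtain ⟨b, rfl⟩ := exists_odd y hy
      rw [← mul_assoc, ← hzc, mul_assoc, ← Subalgebra.coe_mul, σ_even, σ_odd, σ_odd, ψ_mul]
      simp [mul_assoc]
    · obtain ⟨a, rfl⟩ := exists_odd x hx
      obtain ⟨b, rfl⟩ := exists_even y hy
      rw [mul_assoc, ← Subalgebra.coe_mul, σ_even, σ_odd, σ_odd, ψ_mul, mul_smul_comm,
        ← mul_assoc (ψ b : A), ← hzc]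
      simp [mul_assoc]
    · obtain ⟨a, rfl⟩ := exists_odd x hx
      obtain ⟨b, rfl⟩ := exists_odd y hy
      have mul_odd (u v : A) : z * u * (z * v) = c • (u * v) := by
        rw [mul_assoc, ← mul_assoc u, ← hzc u, mul_assoc, ← mul_assoc, hzz, Algebra.smul_def]
      rw [mul_odd, map_smul, ← Subalgebra.coe_mul, σ_even, σ_odd, σ_odd, smul_mul_smul_comm,
        mul_odd, ψ_mul, ← sq s, hs]
      simp [ZMod.val_one]

/-- A superantiautomorphism restricts to an antiautomorphism of the even part. -/
theorem IsSuperAntiAuto.exists_evenPart [FiniteDimensional F A] {σ : A ≃ₗ[F] A}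
    (hσ : IsSuperAntiAuto F 𝒜 σ) :
    ∃ ψ : evenPart F 𝒜 ≃ₗ[F] evenPart F 𝒜, ∀ x y, ψ (x * y) = ψ y * ψ x := by
  let f : evenPart F 𝒜 →ₗ[F] evenPart F 𝒜 :=
    (σ : A →ₗ[F] A).restrict (p := (evenPart F 𝒜).toSubmodule)
      (q := (evenPart F 𝒜).toSubmodule) fun x hx => hσ.1 0 x hx
  have hf : Function.Injective f := fun x y h =>
    Subtype.ext (σ.injective (congrArg Subtype.val h))
  refine ⟨LinearEquiv.ofInjectiveEndo f hf, fun x y => Subtype.ext ?_⟩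
  have := hσ.2 0 0 x x.2 y y.2
  simp only [ZMod.val_zero, mul_zero, pow_zero, one_smul] at this
  exact this

end OddSuperalgebra

/-- A central simple superalgebra of odd type has an `F`-linear superantiautomorphism if
and only if `-1` is a square in `F` and the even part `A₀` has an antiautomorphism. -/
theorem odd_type_superantiauto_iff
    (F : Type*) {A : Type*} [Field F] [Ring A] [Algebra F A]
    (hchar : (2 : F) ≠ 0)
    (𝒜 : ZMod 2 → Submodule F A) [GradedAlgebra 𝒜]
    (hfin : FiniteDimensional F A)
    (hcentral : SuperCentral F 𝒜)
    (hsimple : SuperSimple F 𝒜)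
    (hodd : OddType F 𝒜) :
    (∃ σ : A ≃ₗ[F] A, IsSuperAntiAuto F 𝒜 σ) ↔
      ((∃ s : F, s ^ 2 = -1) ∧
       (∃ ψ : evenPart F 𝒜 ≃ₗ[F] evenPart F 𝒜, ∀ x y, ψ (x * y) = ψ y * ψ x)) := by
  obtain ⟨z, hz0, hz, hzc⟩ := hodd
  obtain ⟨c, hc, hzz⟩ := exists_mul_self_eq_algebraMap hcentral hsimple hz0 hz hzc
  constructor
  · rintro ⟨σ, hσ⟩
    exact ⟨hσ.exists_sq_eq_neg_one hcentral hz hzc hc hzz hsimple.1, hσ.exists_evenPart⟩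
  · rintro ⟨⟨s, hs⟩, ψ, hψ⟩
    exact exists_isSuperAntiAuto_of_evenPart hz hzc hc hzz hs ψ hψ
end

section
/- Let D be a finite-dimensional central division algebra over F with D ≠ F, let n, m ≥ 1, and let A = M_{n+m}(D) be the matrix superalgebra over D (even part the block-diagonal matrices with blocks of sizes n and m, odd part the block-off-diagonal matrices). Then the following are equivalent: (i) A has an F-linear superantiautomorphism; (ii) A has an F-linear superinvolution; (iii) D has an F-linear involution. -/
open scoped TensorProduct

/-- A finite-dimensional central division algebra is Azumaya over its center. -/
theorem mulLeftRight_bijective_of_center_eq_bot {F D : Type*} [Field F] [DivisionRing D]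
    [Algebra F D] [FiniteDimensional F D] (hcentral : Subalgebra.center F D = ⊥) :
    Function.Bijective (AlgHom.mulLeftRight F D) := by
  have hsurj : Function.Surjective (AlgHom.mulLeftRight F D) := by
    let S := (AlgHom.mulLeftRight F D).range
    have hmem (a b : D) : AlgHom.mulLeftRight F D (a ⊗ₜ MulOpposite.op b) ∈ S := ⟨_, rfl⟩
    have hsmul (a b x : D) : (⟨_, hmem a b⟩ : S) • x = a * x * b := by
      change AlgHom.mulLeftRight F D (a ⊗ₜ MulOpposite.op b) x = _
      simp
    have : IsSimpleModule S D := by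
      rw [isSimpleModule_iff_toSpanSingleton_surjective]
      refine ⟨inferInstance, fun x hx y => ⟨⟨_, hmem (y * x⁻¹) 1⟩, ?_⟩⟩
      rw [LinearMap.toSpanSingleton_apply, hsmul]
      simp [hx]
    intro f
    have hscalar (e : Module.End S D) : ∃ c : F, ∀ x, e x = c • x := by
      have hl (a x : D) : e (a * x) = a * e x := by
        have h := e.map_smul (⟨_, hmem a 1⟩ : S) x
        rw [hsmul, hsmul] at h
        simpa using h
      have hr (a x : D) : e (x * a) = e x * a := by
        have h := e.map_smul (⟨_, hmem 1 a⟩ : S) x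
        rw [hsmul, hsmul] at h
        simpa using h
      have hc : e 1 ∈ Subalgebra.center F D := by
        rw [Subalgebra.mem_center_iff]
        intro b
        rw [← hl, ← hr, mul_one, one_mul]
      rw [hcentral, Algebra.mem_bot] at hc
      obtain ⟨c, hc⟩ := hc
      refine ⟨c, fun x => ?_⟩
      rw [Algebra.smul_def, hc, ← hr, one_mul]
    let g : Module.End (Module.End S D) D :=
      { toFun := f
        map_add' := f.map_add
        map_smul' := fun e x => by
          obtain ⟨c, hc⟩ := hscalar e
          simp [hc] }
    classical
    obtain ⟨r, hr⟩ := jacobson_density (R := S) (M := D) g (Finset.univ.image (Module.finBasis F D))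
    obtain ⟨t, ht⟩ := r.2
    refine ⟨t, (Module.finBasis F D).ext fun i => ?_⟩
    have h := hr (Module.finBasis F D i) (by simp)
    change f _ = (r : Module.End F D) _ at h
    rw [h, ← ht]
    rfl
  refine ⟨?_, hsurj⟩
  have hrank : Module.finrank F (D ⊗[F] Dᵐᵒᵖ) = Module.finrank F (Module.End F D) := by
    rw [Module.finrank_tensorProduct, Module.finrank_linearMap,
      (MulOpposite.opLinearEquiv F : D ≃ₗ[F] Dᵐᵒᵖ).finrank_eq]
  exact (LinearMap.injective_iff_surjective_of_finrank_eq_finrank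
    (f := (AlgHom.mulLeftRight F D).toLinearMap) hrank).2 hsurj

/-- Over a finite extension `L` of `F`, an `L`-module structure on a finite-dimensional
`F`-space depends only on the dimension. -/
theorem exists_linearEquiv_fun_of_algHom_end {F L V : Type*} [Field F] [Field L] [Algebra F L]
    [FiniteDimensional F L] [AddCommGroup V] [Module F V] [FiniteDimensional F V]
    (φ : L →ₐ[F] Module.End F V) :
    ∃ e : V ≃ₗ[F] (Fin (Module.finrank F V / Module.finrank F L) → L),
      ∀ l x, e (φ l x) = l • e x := by
  let _ : Module L V := Module.compHom V (φ : L →+* Module.End F V)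
  have hsmul (l : L) (x : V) : l • x = φ l x := rfl
  have : IsScalarTower F L V := ⟨fun c l x => by simp [hsmul]⟩
  have : FiniteDimensional L V := Module.Finite.of_restrictScalars_finite F L V
  have hrank : Module.finrank L V = Module.finrank F V / Module.finrank F L := by
    rw [← Module.finrank_mul_finrank F L V, Nat.mul_div_cancel_left _ Module.finrank_pos]
  let e := (Module.finBasisOfFinrankEq L V hrank).equivFun
  exact ⟨e.restrictScalars F, fun l x => e.map_smul l x⟩

open Polynomial in
/-- The universal property of `AdjoinRoot` for maps to noncommutative algebras. -/
theorem AdjoinRoot.exists_algHom_root_eq {F A : Type*} [Field F] [Ring A] [Algebra F A] {f : F[X]}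
    {x : A} (hx : aeval x f = 0) : ∃ φ : AdjoinRoot f →ₐ[F] A, φ (AdjoinRoot.root f) = x := by
  refine ⟨Ideal.Quotient.liftₐ (Ideal.span {f}) (aeval x) fun p hp => ?_, aeval_X x⟩
  obtain ⟨q, rfl⟩ := Ideal.mem_span_singleton'.1 hp
  rw [map_mul, hx, mul_zero]

open Polynomial in
/-- An endomorphism whose square is a non-square scalar is conjugate to its negative. -/
theorem exists_linearEquiv_anticommute {F V : Type*} [Field F] [AddCommGroup V] [Module F V]
    [FiniteDimensional F V] {T : Module.End F V} {c : F} (hT : T * T = algebraMap F _ c)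
    (hc : ¬ IsSquare c) : ∃ J : V ≃ₗ[F] V, ∀ x, J (T x) = -T (J x) := by
  have hirr : Irreducible (X ^ 2 - C c : F[X]) := by
    rw [X_pow_sub_C_irreducible_iff_of_prime Nat.prime_two]
    rintro b rfl
    exact hc ⟨b, sq b⟩
  have : Fact (Irreducible (X ^ 2 - C c : F[X])) := ⟨hirr⟩
  have : FiniteDimensional F (AdjoinRoot (X ^ 2 - C c : F[X])) :=
    (AdjoinRoot.powerBasis hirr.ne_zero).finite
  have h₁ : aeval T (X ^ 2 - C c : F[X]) = 0 := by simp [sq, hT]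
  have h₂ : aeval (-T) (X ^ 2 - C c : F[X]) = 0 := by simp [sq, hT]
  obtain ⟨φ₁, hφ₁⟩ := AdjoinRoot.exists_algHom_root_eq h₁
  obtain ⟨φ₂, hφ₂⟩ := AdjoinRoot.exists_algHom_root_eq h₂
  obtain ⟨e₁, he₁⟩ := exists_linearEquiv_fun_of_algHom_end φ₁
  obtain ⟨e₂, he₂⟩ := exists_linearEquiv_fun_of_algHom_end φ₂
  refine ⟨e₁.trans e₂.symm, fun x => ?_⟩
  have h₁ := he₁ (AdjoinRoot.root _) x
  have h₂ := he₂ (AdjoinRoot.root _) (e₂.symm (e₁ x))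
  rw [hφ₁] at h₁
  rw [hφ₂] at h₂
  rw [LinearEquiv.apply_symm_apply, ← h₁] at h₂
  simpa using (e₂.symm_apply_eq.2 h₂.symm)

/-- There are more symmetric than antisymmetric tensors. -/
theorem not_injective_of_symm_to_antisymm {F V : Type*} [Field F] (hchar : (2 : F) ≠ 0)
    [AddCommGroup V] [Module F V] [FiniteDimensional F V] [Nontrivial V]
    (K : V ⊗[F] V →ₗ[F] V ⊗[F] V)
    (hK : ∀ t, TensorProduct.comm F V V t = t → TensorProduct.comm F V V (K t) = -K t) :
    ¬ Function.Injective K := by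
  intro hinj
  let b := Module.finBasis F V
  let B := b.tensorProduct b
  have hcomm (t : V ⊗[F] V) (i j) :
      B.repr (TensorProduct.comm F V V t) (i, j) = B.repr t (j, i) := by
    induction t with
    | zero => simp
    | tmul x y => simp [B, mul_comm]
    | add x y hx hy => simp [hx, hy]
  let sgn (p : Fin (Module.finrank F V) × Fin (Module.finrank F V)) : F :=
    if p.1 < p.2 then 1 else if p.2 < p.1 then -1 else 0
  have hsgn_swap (i j) : sgn (i, j) = -sgn (j, i) := by
    rcases lt_trichotomy i j with h | rfl | h
    · simp [sgn, h, h.not_gt]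
    · simp [sgn]
    · simp [sgn, h, h.not_gt]
  have hsgn_ne {i j} (h : i ≠ j) : sgn (i, j) ≠ 0 := by
    rcases lt_or_gt_of_ne h with h | h
    · simp [sgn, h]
    · simp [sgn, h, h.not_gt]
  let φ : V ⊗[F] V →ₗ[F] V ⊗[F] V := B.equivFun.symm.toLinearMap ∘ₗ
    (LinearMap.pi fun p => sgn p • LinearMap.proj p) ∘ₗ B.equivFun.toLinearMap
  have hφ (t p) : B.repr (φ t) p = sgn p * B.repr t p := by
    rw [← B.equivFun_apply, LinearMap.comp_apply, LinearEquiv.coe_coe,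
      LinearEquiv.apply_symm_apply]
    simp
  let P := LinearMap.eqLocus (TensorProduct.comm F V V).toLinearMap LinearMap.id
  have hP (t) : t ∈ P ↔ TensorProduct.comm F V V t = t := Iff.rfl
  have hanti (t) (ht : t ∈ P) (i j) : B.repr (K t) (j, i) = -B.repr (K t) (i, j) := by
    rw [← hcomm, hK t ht]
    simp
  have hmaps : ∀ t ∈ P, (φ ∘ₗ K) t ∈ P := by
    intro t ht
    rw [hP]
    apply B.repr.injective
    ext ⟨i, j⟩
    rw [hcomm, LinearMap.comp_apply, hφ, hφ, hanti t ht, hsgn_swap]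
    ring
  let f := (φ ∘ₗ K).restrict hmaps
  have hf : Function.Injective f := by
    rw [← LinearMap.ker_eq_bot, LinearMap.ker_eq_bot']
    rintro ⟨t, ht⟩ h
    have h0 : φ (K t) = 0 := congrArg Subtype.val h
    have hKt : K t = 0 := by
      apply B.repr.injective
      ext ⟨i, j⟩
      rw [map_zero, Finsupp.zero_apply]
      by_cases hij : i = j
      · subst hij
        have := hanti t ht i i
        rw [eq_neg_iff_add_eq_zero, ← two_mul] at this
        exact (mul_eq_zero.1 this).resolve_left hchar
      · have := hφ (K t) (i, j)
        rw [h0, map_zero, Finsupp.zero_apply, eq_comm] at this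
        exact (mul_eq_zero.1 this).resolve_left (hsgn_ne hij)
    exact Subtype.ext (hinj (hKt.trans (map_zero K).symm))
  let i : Fin (Module.finrank F V) := ⟨0, Module.finrank_pos⟩
  have hsurj := LinearMap.injective_iff_surjective.1 hf
  obtain ⟨⟨t, ht⟩, h⟩ := hsurj ⟨b i ⊗ₜ b i, by simp [hP]⟩
  have h : φ (K t) = b i ⊗ₜ b i := congrArg Subtype.val h
  have := hφ (K t) (i, i)
  rw [h] at this
  simp [B, sgn] at this

/-- **Albert's theorem** for division algebras: a central division algebra isomorphic to its
opposite has an involution. -/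
theorem exists_involution_of_algEquiv_op {F D : Type*} [Field F] (hchar : (2 : F) ≠ 0)
    [DivisionRing D] [Algebra F D] [FiniteDimensional F D]
    (hcentral : Subalgebra.center F D = ⊥) (θ : D ≃ₐ[F] Dᵐᵒᵖ) :
    ∃ ψ : D ≃ₗ[F] D, (∀ x y : D, ψ (x * y) = ψ y * ψ x) ∧ ∀ x, ψ (ψ x) = x := by
  let Ψ : D ⊗[F] D ≃ₐ[F] Module.End F D :=
    (Algebra.TensorProduct.congr AlgEquiv.refl θ).trans
      (AlgEquiv.ofBijective _ (mulLeftRight_bijective_of_center_eq_bot hcentral))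
  have hΨ (a b x : D) : Ψ (a ⊗ₜ b) x = a * x * (θ b).unop := by simp [Ψ]
  obtain ⟨T, hT⟩ := AlgEquiv.eq_linearEquivConjAlgEquiv
    ((Ψ.symm.trans (Algebra.TensorProduct.comm F D D)).trans Ψ)
  have hswap (t : D ⊗[F] D) (x : D) :
      T (Ψ t x) = Ψ (TensorProduct.comm F D D t) (T x) := by
    have h := congr($hT (Ψ t) (T x))
    rw [LinearEquiv.conjAlgEquiv_apply] at h
    have hcomm : Algebra.TensorProduct.comm F D D t = TensorProduct.comm F D D t := rfl
    simpa [hcomm] using h.symm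
  obtain ⟨c, hc⟩ : ∃ c : F, ∀ x, T (T x) = c • x := by
    have hmem : (T.toLinearMap * T.toLinearMap : Module.End F D) ∈
        Subalgebra.center F (Module.End F D) := by
      rw [Subalgebra.mem_center_iff]
      intro f
      obtain ⟨t, rfl⟩ := Ψ.surjective f
      ext x
      simp [hswap]
    rw [Algebra.IsCentral.center_eq_bot, Algebra.mem_bot] at hmem
    obtain ⟨c, hc⟩ := hmem
    exact ⟨c, fun x => congr($hc x).symm⟩
  have hsq : IsSquare c := by
    by_contra hns
    obtain ⟨J, hJ⟩ := exists_linearEquiv_anticommute (T := T.toLinearMap) (c := c)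
      (by ext x; simp [hc]) hns
    simp only [LinearEquiv.coe_coe] at hJ
    refine not_injective_of_symm_to_antisymm hchar (Ψ.symm.toLinearMap ∘ₗ
      LinearMap.mulLeft F J.toLinearMap ∘ₗ Ψ.toLinearMap) (fun t ht => ?_) ?_
    · apply Ψ.injective
      ext x
      obtain ⟨y, rfl⟩ := T.surjective x
      rw [← hswap]
      have h := hswap t y
      rw [ht] at h
      simp [← h, hJ]
    · refine Ψ.symm.injective.comp (Function.Injective.comp (g := LinearMap.mulLeft F _) ?_
        Ψ.injective)
      intro f g h
      ext x
      exact J.injective congr($h x)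
  obtain ⟨s, rfl⟩ := hsq
  obtain ⟨v, hv, r, hr, hTv⟩ : ∃ v : D, v ≠ 0 ∧ ∃ r : F, r * r = s * s ∧ T v = r • v := by
    by_cases h : T 1 = s • 1
    · exact ⟨1, one_ne_zero, s, rfl, h⟩
    · refine ⟨T 1 - s • 1, sub_ne_zero.2 h, -s, by ring, ?_⟩
      rw [map_sub, hc, map_smul, smul_sub, smul_smul, neg_smul, neg_mul, neg_smul]
      abel
  have hr0 : r ≠ 0 := by
    rintro rfl
    rw [zero_smul, LinearEquiv.map_eq_zero_iff] at hTv
    exact hv hTv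
  let ψ : D →ₗ[F] D :=
    LinearMap.mulLeft F v ∘ₗ LinearMap.mulRight F v⁻¹ ∘ₗ
      (MulOpposite.opLinearEquiv F).symm.toLinearMap ∘ₗ θ.toLinearMap
  have hψ (a : D) : ψ a * v = v * (θ a).unop := by simp [ψ, mul_assoc, hv]
  have hl (a : D) : T (a * v) = r • (ψ a * v) := by
    have := hswap (a ⊗ₜ 1) v
    rw [TensorProduct.comm_tmul, hΨ, hΨ] at this
    simpa [hTv, hψ] using this
  have hr' (a : D) : T (v * (θ a).unop) = r • (a * v) := by
    have := hswap (1 ⊗ₜ a) v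
    rw [TensorProduct.comm_tmul, hΨ, hΨ] at this
    simpa [hTv] using this
  have hinv : Function.Involutive ψ := by
    intro a
    have h := hl (ψ a)
    rw [hψ, hr'] at h
    exact (mul_right_cancel₀ hv (smul_right_injective D hr0 h)).symm
  refine ⟨LinearEquiv.ofInvolutive ψ hinv, fun x y => ?_, hinv⟩
  change ψ (x * y) = ψ y * ψ x
  apply mul_right_cancel₀ hv
  rw [mul_assoc, hψ x, ← mul_assoc, hψ y, mul_assoc, hψ, map_mul, MulOpposite.unop_mul]

/-- A superantiautomorphism reverses products in which one factor is even. -/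
theorem IsSuperAntiAuto.map_mul_of_mem_zero_s12 {F A : Type*} [Field F] [Ring A] [Algebra F A]
    {𝒜 : ZMod 2 → Submodule F A} {σ : A ≃ₗ[F] A} (hσ : IsSuperAntiAuto F 𝒜 σ)
    (hsup : 𝒜 0 ⊔ 𝒜 1 = ⊤) {x : A} (hx : x ∈ 𝒜 0) (y : A) :
    σ (x * y) = σ y * σ x ∧ σ (y * x) = σ x * σ y := by
  obtain ⟨y₀, h₀, y₁, h₁, rfl⟩ := Submodule.mem_sup.1 (hsup ▸ Submodule.mem_top : y ∈ 𝒜 0 ⊔ 𝒜 1)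
  constructor
  · simpa [mul_add, add_mul] using
      congrArg₂ (· + ·) (hσ.2 0 0 x hx y₀ h₀) (hσ.2 0 1 x hx y₁ h₁)
  · simpa [mul_add, add_mul] using
      congrArg₂ (· + ·) (hσ.2 0 0 y₀ h₀ x hx) (hσ.2 1 0 y₁ h₁ x hx)

theorem matGrade_zero_sup_one {F : Type*} [Field F] {D : Type*} [Ring D] [Module F D] (n m : ℕ) :
    matGrade F D n m 0 ⊔ matGrade F D n m 1 = ⊤ := by
  rw [eq_top_iff]
  intro M _
  let p (i j : Fin (n + m)) : ZMod 2 :=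
    (if (i : ℕ) < n then 0 else 1) + (if (j : ℕ) < n then 0 else 1)
  refine Submodule.mem_sup.2 ⟨Matrix.of fun i j => if p i j = 0 then M i j else 0,
    fun i j h => if_neg h, Matrix.of fun i j => if p i j = 0 then 0 else M i j,
    fun i j h => ?_, ?_⟩
  · have : p i j = 0 := by
      change p i j ≠ 1 at h
      generalize p i j = q at h
      revert q
      decide
    exact if_pos this
  · ext i j
    by_cases h : p i j = 0 <;> simp [h]

/-- A bijection of a matrix algebra reversing products with the multiples of a diagonal matrix
unit gives an isomorphism of the coefficient division algebra with its opposite. -/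
theorem exists_algEquiv_op_of_corner {F D ι : Type*} [Field F] [DivisionRing D] [Algebra F D]
    [FiniteDimensional F D] [Fintype ι] [DecidableEq ι] (i₀ : ι)
    (σ : Matrix ι ι D ≃ₗ[F] Matrix ι ι D)
    (hσ : ∀ (d : D) (y : Matrix ι ι D),
      σ (Matrix.single i₀ i₀ d * y) = σ y * σ (Matrix.single i₀ i₀ d) ∧
      σ (y * Matrix.single i₀ i₀ d) = σ (Matrix.single i₀ i₀ d) * σ y) :
    Nonempty (D ≃ₐ[F] Dᵐᵒᵖ) := by
  let g (d : D) : Matrix ι ι D := σ (Matrix.single i₀ i₀ d)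
  have hg_mul (a b : D) : g (a * b) = g b * g a := by
    rw [← (hσ a _).1, Matrix.single_mul_single_same]
  have hg_ne {d : D} (hd : d ≠ 0) : g d ≠ 0 := by
    intro h
    rw [LinearEquiv.map_eq_zero_iff] at h
    exact hd (by simpa using congr($h i₀ i₀))
  have hcorner (y : Matrix ι ι D) : ∃ d, g 1 * y * g 1 = g d := by
    refine ⟨σ.symm y i₀ i₀, ?_⟩
    have h₁ := (hσ 1 (σ.symm y * Matrix.single i₀ i₀ 1)).1
    rw [(hσ 1 (σ.symm y)).2, σ.apply_symm_apply, ← mul_assoc,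
      Matrix.single_mul_mul_single] at h₁
    simpa using h₁.symm
  obtain ⟨j, k, hjk⟩ : ∃ j k, g 1 j k ≠ 0 := by
    by_contra! h
    exact hg_ne one_ne_zero (Matrix.ext h)
  let w : ι → D := fun i => g 1 i k
  have hwj : w j ≠ 0 := hjk
  have hfw : (g 1).mulVec w = w := by
    ext i
    have := congr($(hg_mul 1 1) i k)
    rw [one_mul] at this
    exact this.symm
  have hcol {w' : ι → D} (hw' : (g 1).mulVec w' = w') : ∃ d, w' = fun i => w i * d := by
    by_contra! hne
    let u : ι → D := fun i => w' i - w i * ((w j)⁻¹ * w' j)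
    have hu : (g 1).mulVec u = u := by
      have : u = w' - MulOpposite.op ((w j)⁻¹ * w' j) • w := rfl
      rw [this, Matrix.mulVec_sub, Matrix.mulVec_smul, hw', hfw]
    obtain ⟨l, hl⟩ : ∃ l, u l ≠ 0 := by
      by_contra! h
      exact hne ((w j)⁻¹ * w' j) (funext fun i => sub_eq_zero.1 (h i))
    have huj : u j = 0 := by simp [u, hwj]
    let φ : ι → D := Pi.single l 1 - Pi.single j (w l * (w j)⁻¹)
    have hφ (x : ι → D) : φ ⬝ᵥ x = x l - w l * (w j)⁻¹ * x j := by
      simp [φ, sub_dotProduct]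
    let y := Matrix.vecMulVec u φ
    have hy (x : ι → D) : y.mulVec x = fun i => u i * (φ ⬝ᵥ x) := by
      ext i
      simp [y, Matrix.mulVec, dotProduct, Matrix.vecMulVec_apply, Finset.mul_sum, mul_assoc]
    obtain ⟨d, hd⟩ := hcorner y
    have hdw : (g d).mulVec w = 0 := by
      have : φ ⬝ᵥ w = 0 := by simp [hφ, hwj]
      rw [← hd, ← Matrix.mulVec_mulVec, hfw, ← Matrix.mulVec_mulVec, hy, this]
      simp only [mul_zero]
      exact Matrix.mulVec_zero _
    have hdu : (g d).mulVec u ≠ 0 := by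
      have : φ ⬝ᵥ u = u l := by simp [hφ, huj]
      have hyu : y.mulVec u = MulOpposite.op (u l) • u := by rw [hy, this]; rfl
      rw [← hd, ← Matrix.mulVec_mulVec, hu, ← Matrix.mulVec_mulVec, hyu,
        Matrix.mulVec_smul, hu]
      intro h
      exact mul_ne_zero hl hl (congrFun h l)
    have hd0 : d ≠ 0 := by
      rintro rfl
      exact hdu (by simp [g])
    have : w = 0 := by
      rw [← hfw, ← mul_inv_cancel₀ hd0, hg_mul, ← Matrix.mulVec_mulVec, hdw,
        Matrix.mulVec_zero]
    exact hwj (congrFun this j)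
  have hgw (d : D) : ∃ e, (g d).mulVec w = fun i => w i * e :=
    hcol (by rw [Matrix.mulVec_mulVec, ← hg_mul, mul_one])
  let θ : D →ₗ[F] Dᵐᵒᵖ :=
    { toFun := fun d => MulOpposite.op ((w j)⁻¹ * (g d).mulVec w j)
      map_add' := fun a b => by
        simp [g, Matrix.single_add, Matrix.add_mulVec, mul_add]
      map_smul' := fun c a => by
        simp [g, ← Matrix.smul_single, Matrix.smul_mulVec] }
  have hθ (d : D) : (g d).mulVec w = MulOpposite.op (θ d).unop • w := by
    obtain ⟨e, he⟩ := hgw d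
    have : (θ d).unop = e := by
      change (w j)⁻¹ * (g d).mulVec w j = e
      rw [he, inv_mul_cancel_left₀ hwj]
    rw [this, he]
    rfl
  have hθ_one : θ 1 = 1 := by
    change MulOpposite.op ((w j)⁻¹ * (g 1).mulVec w j) = 1
    rw [hfw, inv_mul_cancel₀ hwj, MulOpposite.op_one]
  have hθ_mul (a b : D) : θ (a * b) = θ a * θ b := by
    apply MulOpposite.unop_injective
    apply mul_left_cancel₀ hwj
    have h := hθ (a * b)
    rw [hg_mul, ← Matrix.mulVec_mulVec, hθ a, Matrix.mulVec_smul, hθ b] at h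
    have := congrFun h j
    simpa [mul_assoc] using this.symm
  let f : D →ₐ[F] Dᵐᵒᵖ := AlgHom.ofLinearMap θ hθ_one hθ_mul
  have hinj : Function.Injective f := f.toRingHom.injective
  refine ⟨AlgEquiv.ofBijective f ⟨hinj, ?_⟩⟩
  exact (LinearMap.injective_iff_surjective_of_finrank_eq_finrank (f := f.toLinearMap)
    (MulOpposite.opLinearEquiv F : D ≃ₗ[F] Dᵐᵒᵖ).finrank_eq).1 hinj

/-- A noncommutative central division algebra with an involution has a nonzero skew element. -/
theorem exists_skew_of_involution {F D : Type*} [Field F] [DivisionRing D] [Algebra F D]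
    (hcentral : Subalgebra.center F D = ⊥) (hDneF : (⊥ : Subalgebra F D) ≠ ⊤) (ψ : D ≃ₗ[F] D)
    (hmul : ∀ x y : D, ψ (x * y) = ψ y * ψ x) (hinv : ∀ x, ψ (ψ x) = x) :
    ∃ s : D, s ≠ 0 ∧ ψ s = -s := by
  by_contra! h
  have hid (x : D) : ψ x = x := by
    by_contra hx
    exact h (x - ψ x) (sub_ne_zero.2 (Ne.symm hx)) (by simp [hinv])
  apply hDneF
  rw [← hcentral, eq_top_iff]
  intro x _
  rw [Subalgebra.mem_center_iff]
  intro y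
  simpa [hid] using hmul y x

/-- The orthosymplectic-type superinvolution attached to an involution and a skew element. -/
theorem exists_superInvolution_of_involution {F D : Type*} [Field F] [DivisionRing D]
    [Algebra F D] (n m : ℕ) (ψ : D ≃ₗ[F] D) (hmul : ∀ x y : D, ψ (x * y) = ψ y * ψ x)
    (hinv : ∀ x, ψ (ψ x) = x) {s : D} (hs : s ≠ 0) (hψs : ψ s = -s) :
    ∃ τ : Matrix (Fin (n + m)) (Fin (n + m)) D ≃ₗ[F] Matrix (Fin (n + m)) (Fin (n + m)) D,
      IsSuperInvolution F (matGrade F D n m) τ := by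
  let h (i : Fin (n + m)) : D := if (i : ℕ) < n then 1 else s
  let ε (i j : Fin (n + m)) : F := if (i : ℕ) < n then (if (j : ℕ) < n then 1 else -1) else 1
  let η (i : Fin (n + m)) : F := if (i : ℕ) < n then 1 else -1
  have hh (i) : h i ≠ 0 := by
    by_cases hi : (i : ℕ) < n <;> simp [h, hi, hs]
  have hψ1 : ψ 1 = 1 := by
    have := hmul 1 (ψ 1)
    rw [one_mul, hinv, one_mul] at this
    exact this.symm
  have hψinv (x : D) (hx : x ≠ 0) : ψ x⁻¹ = (ψ x)⁻¹ := by
    apply eq_inv_of_mul_eq_one_left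
    rw [← hmul, mul_inv_cancel₀ hx, hψ1]
  have hψh (i) : ψ (h i) = η i • h i := by
    by_cases hi : (i : ℕ) < n <;> simp [h, η, hi, hψ1, hψs]
  have hψh' (i) : ψ (h i)⁻¹ = η i • (h i)⁻¹ := by
    rw [hψinv _ (hh i), hψh]
    by_cases hi : (i : ℕ) < n <;> simp [η, hi, inv_neg]
  have hsign (i j) : ε i j * ε j i * (η i * η j) = 1 := by
    by_cases hi : (i : ℕ) < n <;> by_cases hj : (j : ℕ) < n <;> simp [ε, η, hi, hj]
  let τ : Matrix (Fin (n + m)) (Fin (n + m)) D →ₗ[F] Matrix (Fin (n + m)) (Fin (n + m)) D :=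
    { toFun := fun X => Matrix.of fun i j => ε i j • ((h i)⁻¹ * ψ (X j i) * h j)
      map_add' := fun X Y => by
        ext i j
        simp [mul_add, add_mul]
      map_smul' := fun c X => by
        ext i j
        simp [smul_comm c] }
  have hτ (X i j) : τ X i j = ε i j • ((h i)⁻¹ * ψ (X j i) * h j) := rfl
  have hτinv : Function.Involutive τ := by
    intro X
    ext i j
    rw [hτ, hτ, map_smul, hmul, hmul, hinv, hψh, hψh']
    simp only [mul_smul_comm, smul_mul_assoc, smul_smul]
    rw [show (h i)⁻¹ * (h i * (X i j * (h j)⁻¹)) * h j = X i j by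
      simp [hh]]
    rw [show ∀ x : D, ∀ r : F, r = 1 → r • x = x from fun x r hr => by rw [hr, one_smul]]
    linear_combination hsign i j
  refine ⟨LinearEquiv.ofInvolutive τ hτinv, ⟨fun k X hX i j hij => ?_, ?_⟩, hτinv⟩
  · change τ X i j = 0
    rw [hτ, hX j i (by rwa [add_comm])]
    simp
  · intro p q X hX Y hY
    change τ (X * Y) = ((-1 : F) ^ (p.val * q.val)) • (τ Y * τ X)
    ext i j
    rw [hτ, Matrix.mul_apply, Matrix.smul_apply, Matrix.mul_apply, map_sum, Finset.mul_sum,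
      Finset.sum_mul, Finset.smul_sum, Finset.smul_sum]
    refine Finset.sum_congr rfl fun k _ => ?_
    by_cases hp : ((if (j : ℕ) < n then 0 else 1) + (if (k : ℕ) < n then 0 else 1) : ZMod 2) = p
    swap
    · simp [hτ, hX j k hp]
    by_cases hq : ((if (k : ℕ) < n then 0 else 1) + (if (i : ℕ) < n then 0 else 1) : ZMod 2) = q
    swap
    · simp [hτ, hY k i hq]
    have hε : ε i j = (-1) ^ (p.val * q.val) * (ε i k * ε k j) := by
      have h2 : (1 + 1 : ZMod 2) = 0 := by decide
      subst hp hq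
      by_cases hi : (i : ℕ) < n <;> by_cases hj : (j : ℕ) < n <;> by_cases hk : (k : ℕ) < n <;>
        simp [ε, hi, hj, hk, h2, ZMod.val_one]
    rw [hτ, hτ, hmul, hε]
    simp only [mul_smul_comm, smul_mul_assoc, smul_smul]
    congr 1
    · ring
    · simp [mul_assoc, hh]

/-- For a central division algebra `D ≠ F` and the matrix superalgebra `A = M_{n+m}(D)`,
the following are equivalent: `A` has a superantiautomorphism; `A` has a superinvolution;
`D` has an (`F`-linear) involution. -/
theorem matrix_superalgebra_over_division_superinvolution_iff
    (F : Type*) [Field F] (hchar : (2 : F) ≠ 0)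
    (D : Type*) [DivisionRing D] [Algebra F D] [FiniteDimensional F D]
    (hcentral : Subalgebra.center F D = ⊥)
    (hDneF : (⊥ : Subalgebra F D) ≠ ⊤)
    (n m : ℕ) (hn : 1 ≤ n) (hm : 1 ≤ m) :
    ((∃ σ : Matrix (Fin (n + m)) (Fin (n + m)) D ≃ₗ[F] Matrix (Fin (n + m)) (Fin (n + m)) D,
        IsSuperAntiAuto F (matGrade F D n m) σ) ↔
      (∃ τ : Matrix (Fin (n + m)) (Fin (n + m)) D ≃ₗ[F] Matrix (Fin (n + m)) (Fin (n + m)) D,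
        IsSuperInvolution F (matGrade F D n m) τ)) ∧
    ((∃ τ : Matrix (Fin (n + m)) (Fin (n + m)) D ≃ₗ[F] Matrix (Fin (n + m)) (Fin (n + m)) D,
        IsSuperInvolution F (matGrade F D n m) τ) ↔
      (∃ ψ : D ≃ₗ[F] D, (∀ x y : D, ψ (x * y) = ψ y * ψ x) ∧ ∀ x, ψ (ψ x) = x)) := by

  have hinvolution : (∃ σ : Matrix (Fin (n + m)) (Fin (n + m)) D ≃ₗ[F]
      Matrix (Fin (n + m)) (Fin (n + m)) D, IsSuperAntiAuto F (matGrade F D n m) σ) →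
      ∃ ψ : D ≃ₗ[F] D, (∀ x y : D, ψ (x * y) = ψ y * ψ x) ∧ ∀ x, ψ (ψ x) = x := by
    rintro ⟨σ, hσ⟩
    have i₀ : Fin (n + m) := ⟨0, by omega⟩
    have hmem (d : D) : Matrix.single i₀ i₀ d ∈ matGrade F D n m 0 := by
      intro i j hij
      refine Matrix.single_apply_of_ne _ _ _ _ _ ?_
      rintro ⟨rfl, rfl⟩
      exact hij (CharTwo.add_self_eq_zero _)
    obtain ⟨θ⟩ := exists_algEquiv_op_of_corner i₀ σ fun d y =>
      hσ.map_mul_of_mem_zero_s12 (matGrade_zero_sup_one n m) (hmem d) y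
    exact exists_involution_of_algEquiv_op hchar hcentral θ
  have hsuper : (∃ ψ : D ≃ₗ[F] D, (∀ x y : D, ψ (x * y) = ψ y * ψ x) ∧ ∀ x, ψ (ψ x) = x) →
      ∃ τ : Matrix (Fin (n + m)) (Fin (n + m)) D ≃ₗ[F] Matrix (Fin (n + m)) (Fin (n + m)) D,
        IsSuperInvolution F (matGrade F D n m) τ := by
    rintro ⟨ψ, hmul, hinv⟩
    obtain ⟨s, hs, hψs⟩ := exists_skew_of_involution hcentral hDneF ψ hmul hinv
    exact exists_superInvolution_of_involution n m ψ hmul hinv hs hψs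
  exact ⟨⟨hsuper ∘ hinvolution, fun ⟨τ, hτ⟩ => ⟨τ, hτ.1⟩⟩, ⟨fun ⟨τ, hτ⟩ => hinvolution ⟨τ, hτ.1⟩, hsuper⟩⟩
end
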